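/- arXiv:1510.03999 — 3 statements merged into one kernel-verified Lean document; each statement's English description precedes it below -/
import Mathlib

section
/- For all real numbers a and ψ, setting b := 2a·sin(ψ/2), the series Σ_{l∈ℤ} e^{ilψ} · (J_l(a)² − J_{l−1}(a)·J_{l+1}(a)) converges absolutely and equals J_0(b) + J_2(b). -/
open Real

/-- Bessel function of the first kind of nonnegative integer order `n`. -/
noncomputable def besselJnat (n : ℕ) (x : ℝ) : ℝ :=
  ∑' j : ℕ, ((-1 : ℝ) ^ j / (Nat.factorial j * Nat.factorial (j + n))) * (x / 2) ^ (2 * j + n)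

/-- Bessel function of the first kind of integer order: `J_{-n} = (-1)^n J_n`. -/
noncomputable def besselJ (n : ℤ) (x : ℝ) : ℝ :=
  if 0 ≤ n then besselJnat n.toNat x else (-1 : ℝ) ^ n.natAbs * besselJnat n.natAbs x

/-- Pairs of naturals are classified by their difference and their minimum. -/
def intProdNatEquiv : ℤ × ℕ ≃ ℕ × ℕ where
  toFun p := (p.2 + p.1.toNat, p.2 + (-p.1).toNat)
  invFun p := ((p.1 : ℤ) - p.2, min p.1 p.2)
  left_inv := by
    rintro ⟨n, j⟩
    simp only [Prod.mk.injEq]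
    omega
  right_inv := by
    rintro ⟨p, q⟩
    simp only [Prod.mk.injEq]
    omega

/-- A two-sided form of the Bessel series, uniform in the sign of the order. -/
theorem besselJ_eq_tsum (n : ℤ) (x : ℝ) :
    besselJ n x = ∑' j : ℕ, (x / 2) ^ (j + n.toNat) / (j + n.toNat).factorial *
      ((-(x / 2)) ^ (j + (-n).toNat) / (j + (-n).toNat).factorial) := by
  unfold besselJ besselJnat
  generalize x / 2 = y
  split_ifs with h
  · refine tsum_congr fun j => ?_
    have hn : (-n).toNat = 0 := by omega
    rw [hn, add_zero, neg_pow]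
    field_simp
    ring
  · rw [← tsum_mul_left]
    refine tsum_congr fun j => ?_
    have hn : n.toNat = 0 := by omega
    have hn' : (-n).toNat = n.natAbs := by omega
    rw [hn, hn', add_zero, neg_pow]
    field_simp
    ring

/-- The product of two summable families of complex numbers, summed over pairs. -/
theorem Complex.hasSum_mul {ι κ : Type*} {f : ι → ℂ} {g : κ → ℂ} {s t : ℂ}
    (hf : HasSum f s) (hg : HasSum g t) :
    HasSum (fun p : ι × κ => f p.1 * g p.2) (s * t) :=
  hf.mul hg (summable_mul_of_summable_norm hf.summable.norm hg.summable.norm)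

/-- Summation of a complex double series along the first index. -/
theorem Complex.hasSum_prod_fiberwise {ι κ : Type*} {f : ι × κ → ℂ} {s : ℂ} (hf : HasSum f s) :
    HasSum (fun i => ∑' k, f (i, k)) s :=
  hf.prod_fiberwise fun i => (hf.summable.prod_factor i).hasSum

/-- The generating function of the Bessel functions of integer order. -/
theorem hasSum_besselJ_mul_zpow (x : ℝ) {z : ℂ} (hz : z ≠ 0) :
    HasSum (fun n : ℤ => (besselJ n x : ℂ) * z ^ n)
      (Complex.exp ((x / 2 : ℂ) * (z - z⁻¹))) := by
  have hexp (w : ℂ) : HasSum (fun p : ℕ => w ^ p / p.factorial) (Complex.exp w) := by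
    rw [Complex.exp_eq_exp_ℂ]
    exact NormedSpace.expSeries_div_hasSum_exp w
  have hprod := Complex.hasSum_mul (hexp (x / 2 * z)) (hexp (-(x / 2) * z⁻¹))
  rw [← Complex.exp_add, ← intProdNatEquiv.hasSum_iff] at hprod
  have hfib := Complex.hasSum_prod_fiberwise hprod
  have hval : (x / 2 : ℂ) * (z - z⁻¹) = x / 2 * z + -(x / 2) * z⁻¹ := by ring
  have hfun (n : ℤ) : (besselJ n x : ℂ) * z ^ n = ∑' j : ℕ,
      ((x / 2 * z) ^ (j + n.toNat) / (j + n.toNat).factorial *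
        ((-(x / 2) * z⁻¹) ^ (j + (-n).toNat) / (j + (-n).toNat).factorial) : ℂ) := by
    rw [besselJ_eq_tsum, Complex.ofReal_tsum, ← tsum_mul_right]
    refine tsum_congr fun j => ?_
    have hzn : z ^ n = z ^ (j + n.toNat) * z⁻¹ ^ (j + (-n).toNat) := by
      rw [← zpow_natCast, ← zpow_natCast, inv_zpow', ← zpow_add₀ hz]
      congr 1
      omega
    simp only [mul_pow, hzn]
    push_cast
    ring
  rw [hval, funext hfun]
  exact hfib

/-- The Bessel functions of integer order at a fixed point form an `ℓ¹` sequence. -/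
theorem summable_besselJ (x : ℝ) : Summable fun n : ℤ => (besselJ n x : ℂ) := by
  simpa using (hasSum_besselJ_mul_zpow x one_ne_zero).summable

/-- Multiplying by powers of a unit complex number preserves summability. -/
theorem Summable.mul_zpow_of_norm_eq_one {c : ℤ → ℂ} (hc : Summable c) {u : ℂ} (hu : ‖u‖ = 1) :
    Summable fun n : ℤ => c n * u ^ n := by
  refine Summable.of_norm ?_
  simpa [hu] using hc.norm

/-- An absolutely convergent trigonometric series determines its coefficients. -/
theorem eq_of_tsum_mul_zpow_eq {c d : ℤ → ℂ} (hc : Summable c) (hd : Summable d)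
    (h : ∀ z : ℂ, ‖z‖ = 1 → ∑' n, c n * z ^ n = ∑' n, d n * z ^ n) : c = d := by
  have : Fact (0 < 2 * π) := ⟨Real.two_pi_pos⟩
  have hs {e : ℤ → ℂ} (he : Summable e) :
      Summable fun n => e n • (fourier n : C(AddCircle (2 * π), ℂ)) := by
    refine Summable.of_norm ?_
    simpa [norm_smul, fourier_norm] using he.norm
  have hcoeff {e : ℤ → ℂ} (he : Summable e) (k : ℤ) :
      e k = inner ℂ (fourierLp (T := 2 * π) 2 k)
        (ContinuousMap.toLp (E := ℂ) 2 AddCircle.haarAddCircle ℂ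
          (∑' n, e n • (fourier n : C(AddCircle (2 * π), ℂ)))) := by
    have h1 := ((hs he).hasSum.mapL
      (ContinuousMap.toLp (E := ℂ) 2 AddCircle.haarAddCircle ℂ)).mapL
      (innerSL ℂ (fourierLp (T := 2 * π) 2 k))
    have h2 (n : ℤ) : innerSL ℂ (fourierLp (T := 2 * π) 2 k)
        (ContinuousMap.toLp (E := ℂ) 2 AddCircle.haarAddCircle ℂ
          (e n • (fourier n : C(AddCircle (2 * π), ℂ)))) = if n = k then e k else 0 := by
      have h3 := orthonormal_iff_ite.mp (orthonormal_fourier (T := 2 * π)) k n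
      rw [map_smul, map_smul, innerSL_apply_apply]
      change e n • inner ℂ (fourierLp (T := 2 * π) 2 k) (fourierLp (T := 2 * π) 2 n) = _
      rw [h3]
      by_cases hnk : n = k
      · simp [hnk]
      · simp [hnk, Ne.symm hnk]
    simp only [h2] at h1
    exact (hasSum_ite_eq k (e k)).unique h1
  have hsum : ∑' n, c n • (fourier n : C(AddCircle (2 * π), ℂ)) =
      ∑' n, d n • (fourier n : C(AddCircle (2 * π), ℂ)) := by
    ext t
    rw [← ContinuousMap.tsum_apply (hs hc), ← ContinuousMap.tsum_apply (hs hd)]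
    simpa [fourier_apply, AddCircle.toCircle_zsmul] using
      h (AddCircle.toCircle t : ℂ) (Circle.norm_coe _)
  funext k
  rw [hcoeff hc, hcoeff hd, hsum]

/-- Shear of `ℤ × ℤ` indexing a product of Laurent series by total degree. -/
def intShearEquiv : ℤ × ℤ ≃ ℤ × ℤ where
  toFun p := (p.2, p.2 - p.1)
  invFun p := (p.1 - p.2, p.1)
  left_inv := by rintro ⟨m, l⟩; simp
  right_inv := by rintro ⟨m, l⟩; simp

/-- The terms of the Graf series are absolutely summable over both indices. -/
theorem summable_besselJ_mul_besselJ (a : ℝ) {u : ℂ} (hu : ‖u‖ = 1) :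
    Summable fun p : ℤ × ℤ =>
      (besselJ p.2 a : ℂ) * u ^ p.2 * (besselJ (p.2 - p.1) a : ℂ) := by
  have h := summable_mul_of_summable_norm
    ((summable_besselJ a).mul_zpow_of_norm_eq_one hu).norm (summable_besselJ a).norm
  exact intShearEquiv.summable_iff.mpr h

/-- Graf's addition theorem for two equal radii `a` at angle `ψ`. -/
theorem tsum_besselJ_mul_besselJ (a ψ : ℝ) (m : ℤ) :
    ∑' l : ℤ, (besselJ l a : ℂ) * Complex.exp (ψ * Complex.I) ^ l * (besselJ (l - m) a : ℂ) =
      (besselJ m (2 * a * Real.sin (ψ / 2)) : ℂ) *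
        (Complex.I * Complex.exp ((ψ / 2 : ℝ) * Complex.I)) ^ m := by
  set b : ℝ := 2 * a * Real.sin (ψ / 2) with hb
  set v : ℂ := Complex.exp ((ψ / 2 : ℝ) * Complex.I) with hv
  set u : ℂ := Complex.exp (ψ * Complex.I) with hu
  have hv0 : v ≠ 0 := Complex.exp_ne_zero _
  have hun : ‖u‖ = 1 := Complex.norm_exp_ofReal_mul_I ψ
  have hvn : ‖v‖ = 1 := Complex.norm_exp_ofReal_mul_I (ψ / 2)
  have huv : u = v ^ 2 := by
    rw [hu, hv, ← Complex.exp_nat_mul]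
    congr 1
    push_cast
    ring
  have hbv : (b : ℂ) = a * (v⁻¹ - v) * Complex.I := by
    rw [hb, hv, ← Complex.exp_neg]
    push_cast
    rw [Complex.sin]
    ring_nf
  have hsum := summable_besselJ_mul_besselJ a hun
  refine congrFun (eq_of_tsum_mul_zpow_eq
    (c := fun m => ∑' l : ℤ, (besselJ l a : ℂ) * u ^ l * (besselJ (l - m) a : ℂ))
    (d := fun m => (besselJ m b : ℂ) * (Complex.I * v) ^ m) hsum.prod
    ((summable_besselJ b).mul_zpow_of_norm_eq_one (by simp [hvn])) fun z hz => ?_) m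
  have hz0 : z ≠ 0 := norm_ne_zero_iff.mp (by simp [hz])
  have hu0 : u ≠ 0 := Complex.exp_ne_zero _
  have hl := hasSum_besselJ_mul_zpow a (mul_ne_zero hu0 hz0)
  have hr := hasSum_besselJ_mul_zpow a (inv_ne_zero hz0)
  have hprod := Complex.hasSum_mul hl hr
  rw [← Complex.exp_add, ← intShearEquiv.hasSum_iff] at hprod
  have hfib := Complex.hasSum_prod_fiberwise hprod
  have hleft : HasSum (fun m : ℤ =>
      (∑' l : ℤ, (besselJ l a : ℂ) * u ^ l * (besselJ (l - m) a : ℂ)) * z ^ m)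
      (Complex.exp (a / 2 * (u * z - (u * z)⁻¹) + a / 2 * (z⁻¹ - z⁻¹⁻¹))) := by
    refine hfib.congr_fun fun m => ?_
    rw [← tsum_mul_right]
    refine tsum_congr fun l => ?_
    have hzm : z ^ m = z ^ l * z⁻¹ ^ (l - m) := by
      rw [inv_zpow', ← zpow_add₀ hz0]
      congr 1
      ring
    simp only [intShearEquiv, Function.comp, Equiv.coe_fn_mk, mul_zpow, hzm]
    ring
  have hright := hasSum_besselJ_mul_zpow b (mul_ne_zero (mul_ne_zero Complex.I_ne_zero hv0) hz0)
  rw [hleft.tsum_eq]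
  simp only [mul_assoc (besselJ _ b : ℂ), ← mul_zpow]
  rw [hright.tsum_eq]
  congr 1
  rw [hbv, huv]
  simp only [mul_inv, Complex.inv_I, inv_inv]
  field_simp
  ring_nf
  simp only [Complex.I_sq]
  ring

/-- `Σ_{l∈ℤ} e^{ilψ} (J_l(a)² − J_{l−1}(a) J_{l+1}(a)) = J_0(b) + J_2(b)` with
`b = 2a sin(ψ/2)`, the series converging absolutely. -/
theorem diagonal_lommel_series (a ψ : ℝ) :
    Summable (fun l : ℤ =>
      ‖Complex.exp ((l : ℂ) * (ψ : ℂ) * Complex.I) *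
        (((besselJ l a : ℂ)) ^ 2 - (besselJ (l - 1) a : ℂ) * (besselJ (l + 1) a : ℂ))‖) ∧
    ∑' l : ℤ, Complex.exp ((l : ℂ) * (ψ : ℂ) * Complex.I) *
        (((besselJ l a : ℂ)) ^ 2 - (besselJ (l - 1) a : ℂ) * (besselJ (l + 1) a : ℂ))
      = (besselJ 0 (2 * a * Real.sin (ψ / 2)) : ℂ) + (besselJ 2 (2 * a * Real.sin (ψ / 2)) : ℂ) := by
  set u : ℂ := Complex.exp (ψ * Complex.I) with hu
  have hu0 : u ≠ 0 := Complex.exp_ne_zero _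
  have hexp (l : ℤ) : Complex.exp ((l : ℂ) * (ψ : ℂ) * Complex.I) = u ^ l := by
    rw [hu, ← Complex.exp_int_mul, mul_assoc]
  have hsum := summable_besselJ_mul_besselJ a (Complex.norm_exp_ofReal_mul_I ψ)
  have h0 : HasSum (fun l : ℤ => u ^ l * (besselJ l a : ℂ) ^ 2)
      (besselJ 0 (2 * a * Real.sin (ψ / 2))) := by
    have h := (hsum.prod_factor 0).hasSum
    rw [tsum_besselJ_mul_besselJ, zpow_zero, mul_one] at h
    refine h.congr_fun fun l => ?_
    rw [sub_zero]
    ring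
  have h2 : HasSum (fun l : ℤ => u ^ l * ((besselJ (l - 1) a : ℂ) * (besselJ (l + 1) a : ℂ)))
      (-(besselJ 2 (2 * a * Real.sin (ψ / 2)) : ℂ)) := by
    have h := (hsum.prod_factor 2).hasSum
    have hv : Complex.exp ((ψ / 2 : ℝ) * Complex.I) ^ 2 = u := by
      rw [hu, ← Complex.exp_nat_mul]
      congr 1
      push_cast
      ring
    rw [tsum_besselJ_mul_besselJ, ← (Equiv.addRight (1 : ℤ)).hasSum_iff] at h
    have hval : -(besselJ 2 (2 * a * Real.sin (ψ / 2)) : ℂ) =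
        u⁻¹ * ((besselJ 2 (2 * a * Real.sin (ψ / 2)) : ℂ) *
          (Complex.I * Complex.exp ((ψ / 2 : ℝ) * Complex.I)) ^ (2 : ℤ)) := by
      rw [mul_zpow, zpow_ofNat, zpow_ofNat, hv, Complex.I_sq]
      field_simp
    rw [hval]
    refine (h.mul_left u⁻¹).congr_fun fun l => ?_
    simp only [Function.comp, Equiv.coe_addRight, ← hu]
    rw [zpow_add_one₀ hu0, show l + 1 - 2 = l - 1 by ring]
    field_simp
  have h := h0.sub h2
  simp only [← mul_sub, sub_neg_eq_add] at h
  simp only [hexp]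
  exact ⟨h.summable.norm, h.tsum_eq⟩
end

section
/- Fix an even integer N ≥ 2. For each integer m₀ ≥ 1 set θ_I := 2πI/(2N+1) for I = 0,…,2N and x_J := (4m₀+2J+1)π/4 for J = 1,…,N, and let A(m₀) be the real matrix with (2N+1)·N rows indexed by pairs (I,J) and 2N columns indexed by pairs (l,c) with l ∈ {1,…,N} and c ∈ {1,2}, whose entries are A[(I,J),(l,1)] := cos(l·θ_I)·J_l(x_J) and A[(I,J),(l,2)] := sin(l·θ_I)·J_l(x_J). Then there exist a constant C_N > 0 and an integer m* ≥ 1 such that for every m₀ ≥ m*, A(m₀) is injective and κ(A(m₀)) ≤ 1 + C_N/m₀; in particular κ(A(m₀)) → 1 as m₀ → ∞, and the infimum over m₀ ≥ m* of κ(A(m₀)) equals 1. -/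
open Real

/-- The largest singular value `σ_max(A) = sup { ‖A v‖ : ‖v‖ = 1 }` of a linear map. -/
noncomputable def sigmaMax {𝕜 E F : Type*} [RCLike 𝕜] [NormedAddCommGroup E]
    [NormedAddCommGroup F] [NormedSpace 𝕜 E] [NormedSpace 𝕜 F] (A : E →ₗ[𝕜] F) : ℝ :=
  sSup ((fun v => ‖A v‖) '' {v : E | ‖v‖ = 1})

/-- The smallest singular value `σ_min(A) = inf { ‖A v‖ : ‖v‖ = 1 }` of a linear map. -/
noncomputable def sigmaMin {𝕜 E F : Type*} [RCLike 𝕜] [NormedAddCommGroup E]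
    [NormedAddCommGroup F] [NormedSpace 𝕜 E] [NormedSpace 𝕜 F] (A : E →ₗ[𝕜] F) : ℝ :=
  sInf ((fun v => ‖A v‖) '' {v : E | ‖v‖ = 1})

/-- Condition number `κ(A) = σ_max(A)/σ_min(A)` of a linear map. -/
noncomputable def condNumber {𝕜 E F : Type*} [RCLike 𝕜] [NormedAddCommGroup E]
    [NormedAddCommGroup F] [NormedSpace 𝕜 E] [NormedSpace 𝕜 F] (A : E →ₗ[𝕜] F) : ℝ :=
  sigmaMax A / sigmaMin A

/-- The constrained phaseless measurement matrix: rows indexed by `(I, J)` with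
`I = 0,…,2N` and `J = 1,…,N` (encoded as `Fin (2N+1) × Fin N`, with `J = j+1`),
columns indexed by `(l, c)` with `l = 1,…,N` (encoded as `l = l'+1`) and `c ∈ {1,2}`,
with entries `cos(lθ_I)·J_l(x_J)` (for `c = 0`) and `sin(lθ_I)·J_l(x_J)` (for `c = 1`),
where `θ_I = 2πI/(2N+1)` and `x_J = (4m₀+2J+1)π/4`. -/
noncomputable def phaselessMatrix (N m₀ : ℕ) :
    Matrix ((Fin (2 * N + 1)) × Fin N) ((Fin N) × Fin 2) ℝ := fun p q =>
  (if q.2 = 0 then Real.cos ((q.1.1 + 1 : ℕ) * (2 * π * (p.1.1 : ℝ) / (2 * N + 1)))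
    else Real.sin ((q.1.1 + 1 : ℕ) * (2 * π * (p.1.1 : ℝ) / (2 * N + 1)))) *
    besselJnat (q.1.1 + 1) ((4 * (m₀ : ℝ) + 2 * ((p.2.1 : ℝ) + 1) + 1) * π / 4)


/-- The entire function `∑ (-1)ʲ yʲ / (j! (j+n)!)`, in terms of which
`J_n x = (x/2)ⁿ g_n (x²/4)`. -/
noncomputable def besselSeries (n : ℕ) (y : ℝ) : ℝ :=
  ∑' j : ℕ, (-1 : ℝ) ^ j / (Nat.factorial j * Nat.factorial (j + n)) * y ^ j

lemma norm_besselCoeff_le (n j : ℕ) :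
    ‖(-1 : ℝ) ^ j / (Nat.factorial j * Nat.factorial (j + n))‖ ≤ 1 / Nat.factorial j := by
  have h1 : (1 : ℝ) ≤ Nat.factorial (j + n) := by
    exact_mod_cast Nat.succ_le_of_lt (Nat.factorial_pos _)
  have h0 : (0 : ℝ) < Nat.factorial j := by exact_mod_cast Nat.factorial_pos _
  rw [norm_div, norm_pow, norm_neg, norm_one, one_pow, Real.norm_of_nonneg (by positivity)]
  gcongr
  nlinarith

lemma summable_besselSeries (n : ℕ) (y : ℝ) :
    Summable fun j : ℕ => (-1 : ℝ) ^ j / (Nat.factorial j * Nat.factorial (j + n)) * y ^ j := by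
  refine Summable.of_norm_bounded (g := fun j : ℕ => |y| ^ j / Nat.factorial j)
    (Real.summable_pow_div_factorial _) fun j => ?_
  rw [norm_mul, norm_pow, Real.norm_eq_abs y]
  calc _ ≤ 1 / (Nat.factorial j : ℝ) * |y| ^ j := by gcongr; exact norm_besselCoeff_le n j
    _ = _ := by ring

lemma besselJnat_eq (n : ℕ) (x : ℝ) :
    besselJnat n x = (x / 2) ^ n * besselSeries n (x ^ 2 / 4) := by
  rw [besselJnat, besselSeries, ← tsum_mul_left]
  congr 1 with j
  rw [pow_add, pow_mul, show (x / 2) ^ 2 = x ^ 2 / 4 by ring]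
  ring

lemma hasDerivAt_besselSeries (n : ℕ) (y : ℝ) :
    HasDerivAt (besselSeries n) (-besselSeries (n + 1) y) y := by
  set R := |y| + 1
  have hR : 0 < R := by positivity
  set u : ℕ → ℝ := fun j => 1 / (Nat.factorial j : ℝ) * (j * R ^ (j - 1))
  have hu : Summable u := by
    rw [← summable_nat_add_iff 1]
    refine (Real.summable_pow_div_factorial R).congr fun j => ?_
    simp only [u, Nat.factorial_succ, Nat.add_sub_cancel]
    push_cast
    have : (Nat.factorial j : ℝ) ≠ 0 := by positivity
    field_simp
  have key := hasDerivAt_tsum_of_isPreconnected (t := Metric.ball (0 : ℝ) R)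
    (g := fun (j : ℕ) z => (-1 : ℝ) ^ j / (Nat.factorial j * Nat.factorial (j + n)) * z ^ j)
    (g' := fun (j : ℕ) z => (-1 : ℝ) ^ j / (Nat.factorial j * Nat.factorial (j + n)) *
      (j * z ^ (j - 1))) (y₀ := 0) (y := y) hu Metric.isOpen_ball
    (convex_ball _ _).isPreconnected
    (fun j z _ => (hasDerivAt_pow j z).const_mul _) (fun j z hz => ?_)
    (Metric.mem_ball_self hR) (summable_besselSeries n 0) (by simp [R])
  · refine key.congr_deriv ?_
    rw [besselSeries, ← tsum_neg, (Summable.of_norm_bounded hu (fun j => ?_)).tsum_eq_zero_add]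
    · simp only [Nat.cast_zero, zero_mul, mul_zero, zero_add, Nat.add_sub_cancel]
      congr 1 with j
      rw [pow_succ, Nat.factorial_succ, show j + 1 + n = j + (n + 1) by ring]
      push_cast
      have : (Nat.factorial j : ℝ) ≠ 0 := by positivity
      field_simp
    · rw [norm_mul]
      refine mul_le_mul (norm_besselCoeff_le n j) ?_ (norm_nonneg _) (by positivity)
      rw [norm_mul, norm_pow, Real.norm_natCast]
      gcongr
      simp [R]
  · rw [norm_mul]
    refine mul_le_mul (norm_besselCoeff_le n j) ?_ (norm_nonneg _) (by positivity)
    rw [norm_mul, norm_pow, Real.norm_natCast]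
    gcongr
    exact (mem_ball_zero_iff.1 hz).le

lemma besselSeries_recurrence (n : ℕ) (y : ℝ) :
    besselSeries n y = (n + 1) * besselSeries (n + 1) y - y * besselSeries (n + 2) y := by
  have h1 := summable_besselSeries (n + 1) y
  have h2 := summable_besselSeries (n + 2) y
  have h3 := summable_besselSeries n y
  have h4 : Summable fun j : ℕ => (j : ℝ) *
      ((-1 : ℝ) ^ j / (Nat.factorial j * Nat.factorial (j + (n + 1))) * y ^ j) := by
    refine (h3.sub (h1.mul_left ((n : ℝ) + 1))).congr fun j => ?_
    rw [show j + (n + 1) = (j + n) + 1 by ring, Nat.factorial_succ]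
    push_cast
    have : (Nat.factorial j : ℝ) ≠ 0 := by positivity
    have : (Nat.factorial (j + n) : ℝ) ≠ 0 := by positivity
    have : ((j : ℝ) + n + 1) ≠ 0 := by positivity
    field_simp
    ring
  have h5 : -(y * besselSeries (n + 2) y) = ∑' j : ℕ, (j : ℝ) *
      ((-1 : ℝ) ^ j / (Nat.factorial j * Nat.factorial (j + (n + 1))) * y ^ j) := by
    rw [h4.tsum_eq_zero_add, besselSeries, ← tsum_mul_left, ← tsum_neg]
    simp only [Nat.cast_zero, zero_mul, zero_add]
    congr 1 with j
    rw [show j + 1 + (n + 1) = j + (n + 2) by ring, Nat.factorial_succ]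
    push_cast
    have : (Nat.factorial j : ℝ) ≠ 0 := by positivity
    field_simp
    ring
  rw [sub_eq_add_neg, h5, besselSeries, besselSeries, ← tsum_mul_left,
    ← (h1.mul_left ((n : ℝ) + 1)).tsum_add h4]
  congr 1 with j
  rw [show j + (n + 1) = (j + n) + 1 by ring, Nat.factorial_succ]
  push_cast
  have : (Nat.factorial j : ℝ) ≠ 0 := by positivity
  have : (Nat.factorial (j + n) : ℝ) ≠ 0 := by positivity
  have : ((j : ℝ) + n + 1) ≠ 0 := by positivity
  field_simp
  ring

lemma besselJnat_recurrence (n : ℕ) {x : ℝ} (hx : x ≠ 0) :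
    besselJnat (n + 2) x = 2 * (n + 1) / x * besselJnat (n + 1) x - besselJnat n x := by
  simp only [besselJnat_eq, besselSeries_recurrence n]
  field_simp
  ring

lemma hasDerivAt_besselJnat (n : ℕ) {x : ℝ} (hx : x ≠ 0) :
    HasDerivAt (besselJnat n) (n / x * besselJnat n x - besselJnat (n + 1) x) x := by
  have hp : HasDerivAt (fun z : ℝ => (z / 2) ^ n) (n * (x / 2) ^ (n - 1) * (1 / 2)) x :=
    ((hasDerivAt_id x).div_const 2).pow n
  have hq : HasDerivAt (fun z : ℝ => z ^ 2 / 4) (x / 2) x :=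
    ((hasDerivAt_pow 2 x).div_const 4).congr_deriv (by norm_num; ring)
  have h := hp.mul ((hasDerivAt_besselSeries n (x ^ 2 / 4)).comp x hq)
  refine (h.congr_of_eventuallyEq (.of_forall fun z => besselJnat_eq n z)).congr_deriv ?_
  simp only [besselJnat_eq, Function.comp]
  rcases n with _ | n
  · simp; ring
  · simp only [Nat.add_sub_cancel]
    push_cast
    field_simp
    ring

lemma hasDerivAt_besselJnat_succ (n : ℕ) {x : ℝ} (hx : x ≠ 0) :
    HasDerivAt (besselJnat (n + 1)) (besselJnat n x - (n + 1) / x * besselJnat (n + 1) x) x := by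
  refine (hasDerivAt_besselJnat (n + 1) hx).congr_deriv ?_
  rw [besselJnat_recurrence n hx]
  push_cast
  ring

lemma besselJnat_zero_zero : besselJnat 0 0 = 1 := by
  rw [besselJnat, tsum_eq_single 0 (fun j hj => by simp [hj])]
  simp

lemma continuous_besselJnat (n : ℕ) : Continuous (besselJnat n) := by
  have h : Continuous (besselSeries n) :=
    continuous_iff_continuousAt.2 fun y => (hasDerivAt_besselSeries n y).continuousAt
  have : besselJnat n = fun x => (x / 2) ^ n * besselSeries n (x ^ 2 / 4) :=
    funext (besselJnat_eq n)
  rw [this]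
  fun_prop

/-- The energy `x (J₀² + J₁²) - J₀ J₁`, which converges at infinity. -/
noncomputable def besselEnergy (x : ℝ) : ℝ :=
  x * (besselJnat 0 x ^ 2 + besselJnat 1 x ^ 2) - besselJnat 0 x * besselJnat 1 x

lemma hasDerivAt_besselEnergy {x : ℝ} (hx : x ≠ 0) :
    HasDerivAt besselEnergy (besselJnat 0 x * besselJnat 1 x / x) x := by
  have h0 := hasDerivAt_besselJnat 0 hx
  have h1 := hasDerivAt_besselJnat_succ 0 hx
  refine (((hasDerivAt_id x).mul ((h0.pow 2).add (h1.pow 2))).sub (h0.mul h1)).congr_deriv ?_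
  simp
  field_simp
  ring

lemma abs_mul_le_half_sq_add_sq (a b : ℝ) : |a * b| ≤ (a ^ 2 + b ^ 2) / 2 := by
  rw [abs_le]
  constructor <;> nlinarith [sq_nonneg (a + b), sq_nonneg (a - b)]

lemma sq_add_sq_le_besselEnergy {x : ℝ} (hx : 1 ≤ x) :
    x * ((besselJnat 0 x ^ 2 + besselJnat 1 x ^ 2) / 2) ≤ besselEnergy x := by
  have h := (abs_le.1 (abs_mul_le_half_sq_add_sq (besselJnat 0 x) (besselJnat 1 x))).2
  rw [besselEnergy]
  nlinarith [sq_nonneg (besselJnat 0 x), sq_nonneg (besselJnat 1 x)]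

lemma besselEnergy_deriv_le {x : ℝ} (hx : 1 ≤ x) :
    |besselJnat 0 x * besselJnat 1 x / x| ≤ besselEnergy x / x ^ 2 := by
  have hx0 : 0 < x := by linarith
  have h := abs_mul_le_half_sq_add_sq (besselJnat 0 x) (besselJnat 1 x)
  rw [abs_div, abs_of_pos hx0, div_le_div_iff₀ hx0 (by positivity)]
  nlinarith [sq_add_sq_le_besselEnergy hx, mul_le_mul_of_nonneg_left h hx0.le]

lemma hasDerivAt_besselEnergy_mul_exp (c : ℝ) {x : ℝ} (hx : x ≠ 0) :
    HasDerivAt (fun z => besselEnergy z * exp (c / z))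
      ((besselJnat 0 x * besselJnat 1 x / x - c * (besselEnergy x / x ^ 2)) * exp (c / x)) x := by
  have h : HasDerivAt (fun z : ℝ => c / z) (-c / x ^ 2) x := by
    simpa [div_eq_mul_inv] using (hasDerivAt_inv hx).const_mul c
  refine ((hasDerivAt_besselEnergy hx).mul h.exp).congr_deriv ?_
  ring

lemma monotoneOn_besselEnergy_mul_exp :
    MonotoneOn (fun z => besselEnergy z * exp (-1 / z)) (Set.Ici 1) := by
  have hd (x : ℝ) (hx : x ∈ Set.Ici (1 : ℝ)) :=
    hasDerivAt_besselEnergy_mul_exp (-1) (x := x) (by have : 1 ≤ x := hx; positivity)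
  refine monotoneOn_of_deriv_nonneg (convex_Ici 1)
    (fun x hx => (hd x hx).continuousAt.continuousWithinAt)
    (fun x hx => (hd x (interior_subset hx)).differentiableAt.differentiableWithinAt) fun x hx => ?_
  rw [(hd x (interior_subset hx)).deriv]
  have := (abs_le.1 (besselEnergy_deriv_le (interior_subset hx))).1
  exact mul_nonneg (by linarith) (exp_pos _).le

lemma antitoneOn_besselEnergy_mul_exp :
    AntitoneOn (fun z => besselEnergy z * exp (1 / z)) (Set.Ici 1) := by
  have hd (x : ℝ) (hx : x ∈ Set.Ici (1 : ℝ)) :=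
    hasDerivAt_besselEnergy_mul_exp 1 (x := x) (by have : 1 ≤ x := hx; positivity)
  refine antitoneOn_of_deriv_nonpos (convex_Ici 1)
    (fun x hx => (hd x hx).continuousAt.continuousWithinAt)
    (fun x hx => (hd x (interior_subset hx)).differentiableAt.differentiableWithinAt) fun x hx => ?_
  rw [(hd x (interior_subset hx)).deriv]
  have := (abs_le.1 (besselEnergy_deriv_le (interior_subset hx))).2
  exact mul_nonpos_of_nonpos_of_nonneg (by linarith) (exp_pos _).le

lemma monotoneOn_sq_mul_besselJnat_sq_add_sq :
    MonotoneOn (fun x => x ^ 2 * (besselJnat 0 x ^ 2 + besselJnat 1 x ^ 2)) (Set.Ici 0) := by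
  have hd (x : ℝ) (hx : 0 < x) :
      HasDerivAt (fun x => x ^ 2 * (besselJnat 0 x ^ 2 + besselJnat 1 x ^ 2))
        (2 * x * besselJnat 0 x ^ 2) x := by
    refine ((hasDerivAt_pow 2 x).mul (((hasDerivAt_besselJnat 0 hx.ne').pow 2).add
      ((hasDerivAt_besselJnat_succ 0 hx.ne').pow 2))).congr_deriv ?_
    simp
    field_simp
    ring
  have hc : Continuous fun x => x ^ 2 * (besselJnat 0 x ^ 2 + besselJnat 1 x ^ 2) := by
    have := continuous_besselJnat 0
    have := continuous_besselJnat 1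
    fun_prop
  refine monotoneOn_of_deriv_nonneg (convex_Ici 0) hc.continuousOn ?_ ?_ <;>
    rw [interior_Ici] <;> intro x hx
  · exact (hd x hx).differentiableAt.differentiableWithinAt
  · rw [(hd x hx).deriv]
    have : 0 < x := hx
    positivity

lemma besselEnergy_one_pos : 0 < besselEnergy 1 := by
  have h0 : ∀ᶠ x in nhds (0 : ℝ), 0 < besselJnat 0 x :=
    (continuous_besselJnat 0).continuousAt.eventually_const_lt
      (by rw [besselJnat_zero_zero]; norm_num)
  obtain ⟨ε, hε, h⟩ := Metric.eventually_nhds_iff.1 h0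
  set y := min (ε / 2) 1
  have hy : 0 < y := by positivity
  have hy1 : y ≤ 1 := min_le_right _ _
  have hyε : y < ε := (min_le_left _ _).trans_lt (by linarith)
  have hJ : 0 < besselJnat 0 y := h (by simpa [abs_of_pos hy] using hyε)
  have hm := monotoneOn_sq_mul_besselJnat_sq_add_sq (Set.mem_Ici.2 hy.le)
    (Set.mem_Ici.2 zero_le_one) hy1
  have h1 := sq_add_sq_le_besselEnergy le_rfl
  have h2 : 0 < y ^ 2 * (besselJnat 0 y ^ 2 + besselJnat 1 y ^ 2) := by positivity
  simp only [one_pow, one_mul] at hm h1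
  linarith

lemma exists_besselEnergy_limit : ∃ K : ℝ, 0 < K ∧ ∀ x : ℝ, 1 ≤ x →
    |x * (besselJnat 0 x ^ 2 + besselJnat 1 x ^ 2) - K| ≤ 5 * K / x := by
  set S := (fun z => besselEnergy z * exp (-1 / z)) '' Set.Ici 1
  have hpos (x : ℝ) (hx : 1 ≤ x) : 0 ≤ besselEnergy x := by
    refine le_trans ?_ (sq_add_sq_le_besselEnergy hx)
    positivity
  have hcross (y : ℝ) (hy : 1 ≤ y) : besselEnergy y * exp (1 / y) ∈ upperBounds S := by
    rintro _ ⟨x, hx, rfl⟩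
    have hz : (1 : ℝ) ≤ max x y := le_max_of_le_right hy
    have hz0 : 0 < max x y := by linarith
    calc besselEnergy x * exp (-1 / x) ≤ besselEnergy (max x y) * exp (-1 / max x y) :=
          monotoneOn_besselEnergy_mul_exp hx hz (le_max_left _ _)
      _ ≤ besselEnergy (max x y) * exp (1 / max x y) := by
          have := hpos _ hz
          gcongr
          norm_num
      _ ≤ _ := antitoneOn_besselEnergy_mul_exp hy hz (le_max_right _ _)
  have hne : S.Nonempty := ⟨_, 1, Set.self_mem_Ici, rfl⟩
  have hbdd : BddAbove S := ⟨_, hcross 1 le_rfl⟩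
  have hK : 0 < sSup S := lt_of_lt_of_le (mul_pos besselEnergy_one_pos (exp_pos (-1 / 1)))
    (le_csSup hbdd ⟨1, Set.self_mem_Ici, rfl⟩)
  refine ⟨sSup S, hK, fun x hx => ?_⟩
  set K := sSup S
  have hx0 : 0 < x := by linarith
  have hle : besselEnergy x * exp (-1 / x) ≤ K := le_csSup hbdd ⟨x, hx, rfl⟩
  have hge : K ≤ besselEnergy x * exp (1 / x) := csSup_le hne (hcross x hx)
  have ht0 : 0 < 1 / x := by positivity
  have ht1 : 1 / x ≤ 1 := by rw [div_le_one hx0]; exact hx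
  have he := abs_exp_sub_one_le (x := 1 / x) (by rwa [abs_of_pos ht0])
  rw [abs_of_pos ht0] at he
  have he2 := (abs_le.1 he).2
  rw [neg_div, exp_neg] at hle
  have hle' : besselEnergy x ≤ K * exp (1 / x) := by
    rwa [← div_eq_mul_inv, div_le_iff₀ (exp_pos _)] at hle
  have hge' : K * (1 - 1 / x) ≤ besselEnergy x := by
    have h1 : K * exp (-(1 / x)) ≤ besselEnergy x := by
      rw [exp_neg, ← div_eq_mul_inv, div_le_iff₀ (exp_pos _)]
      exact hge
    have h2 := add_one_le_exp (-(1 / x))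
    nlinarith
  have hG3 : besselEnergy x ≤ 3 * K := by nlinarith
  have hprod : |besselJnat 0 x * besselJnat 1 x| ≤ 3 * K / x := by
    refine (abs_mul_le_half_sq_add_sq _ _).trans ?_
    rw [le_div_iff₀ hx0]
    linarith [sq_add_sq_le_besselEnergy hx]
  have hF : x * (besselJnat 0 x ^ 2 + besselJnat 1 x ^ 2) - K =
      (besselEnergy x - K) + besselJnat 0 x * besselJnat 1 x := by
    rw [besselEnergy]; ring
  have hE : |besselEnergy x - K| ≤ 2 * K / x := by
    rw [show 2 * K / x = 2 * (K * (1 / x)) by ring, abs_le]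
    constructor <;> nlinarith [mul_pos hK ht0]
  rw [hF]
  refine (abs_add_le _ _).trans ((add_le_add hE hprod).trans_eq ?_)
  ring

lemma exists_besselJnat_sq_asymptotics : ∃ K : ℝ, 0 < K ∧ ∀ n : ℕ, ∃ C : ℝ, 0 ≤ C ∧
    ∀ x : ℝ, 1 ≤ x → |x * (besselJnat n x ^ 2 + besselJnat (n + 1) x ^ 2) - K| ≤ C / x := by
  obtain ⟨K, hK, h0⟩ := exists_besselEnergy_limit
  refine ⟨K, hK, fun n => ?_⟩
  induction n with
  | zero => exact ⟨5 * K, by positivity, h0⟩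
  | succ n ih =>
    obtain ⟨C, hC, h⟩ := ih
    set b : ℝ := 2 * (n + 1)
    refine ⟨C + (b ^ 2 + b) * (K + C), by positivity, fun x hx => ?_⟩
    have hx0 : 0 < x := by linarith
    have hb : 0 < b := by positivity
    have hrec := besselJnat_recurrence n hx0.ne'
    have hn := h x hx
    set p := besselJnat n x
    set q := besselJnat (n + 1) x
    have hpq : x * (p ^ 2 + q ^ 2) ≤ K + C := by
      have : C / x ≤ C := div_le_self hC hx
      linarith [(abs_le.1 hn).2]
    have hsplit : x * (q ^ 2 + besselJnat (n + 1 + 1) x ^ 2) - K =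
        (x * (p ^ 2 + q ^ 2) - K) + (b ^ 2 * q ^ 2 / x - 2 * b * (p * q)) := by
      rw [show n + 1 + 1 = n + 2 from rfl, hrec]
      change x * (q ^ 2 + (b / x * q - p) ^ 2) - K = _
      field_simp
      ring
    have h2 : |b ^ 2 * q ^ 2 / x - 2 * b * (p * q)| ≤ (b ^ 2 + b) * (K + C) / x := by
      have hq : b ^ 2 * q ^ 2 / x ≤ b ^ 2 * (K + C) / x := by
        gcongr
        nlinarith [sq_nonneg p, sq_nonneg q]
      have hpq' : |p * q| ≤ (K + C) / (2 * x) := by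
        refine (abs_mul_le_half_sq_add_sq p q).trans ?_
        rw [div_le_div_iff₀ two_pos (by positivity)]
        linarith
      calc _ ≤ |b ^ 2 * q ^ 2 / x| + |2 * b * (p * q)| := abs_sub _ _
        _ = b ^ 2 * q ^ 2 / x + 2 * b * |p * q| := by
            rw [abs_of_nonneg (by positivity), abs_mul, abs_of_pos (by positivity : 0 < 2 * b)]
        _ ≤ b ^ 2 * (K + C) / x + 2 * b * ((K + C) / (2 * x)) := by gcongr
        _ = _ := by field_simp
    rw [hsplit]
    refine (abs_add_le _ _).trans ((add_le_add hn h2).trans_eq ?_)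
    ring

lemma hasDerivAt_besselJnat_rotation (n : ℕ) {x t : ℝ} (hx : x + t ≠ 0) :
    HasDerivAt (fun t => besselJnat n (x + t) * cos t + besselJnat (n + 1) (x + t) * sin t)
      ((n * (besselJnat n (x + t) * cos t) - (n + 1) * (besselJnat (n + 1) (x + t) * sin t))
        / (x + t)) t := by
  have h0 := (hasDerivAt_besselJnat n hx).comp_const_add x t
  have h1 := (hasDerivAt_besselJnat_succ n hx).comp_const_add x t
  refine ((h0.mul (hasDerivAt_cos t)).add (h1.mul (hasDerivAt_sin t))).congr_deriv ?_
  field_simp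
  ring

lemma abs_besselJnat_shift_sq_sub_sq_le {n : ℕ} {B : ℝ}
    (h : ∀ x : ℝ, 1 ≤ x → x * (besselJnat n x ^ 2 + besselJnat (n + 1) x ^ 2) ≤ B) (x : ℝ)
    (hx : 1 ≤ x) :
    |besselJnat (n + 1) (x + π / 2) ^ 2 - besselJnat n x ^ 2| ≤ π * (2 * n + 1) * B / x ^ 2 := by
  have hB : 0 ≤ B := le_trans (by positivity) (h 1 le_rfl)
  have hx0 : 0 < x := by linarith
  set e := √(B / x)
  have he : e ^ 2 = B / x := sq_sqrt (by positivity)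
  have hsq (s : ℝ) (hs : x ≤ s) : besselJnat n s ^ 2 + besselJnat (n + 1) s ^ 2 ≤ e ^ 2 := by
    rw [he, le_div_iff₀ hx0]
    refine le_trans ?_ (h s (hx.trans hs))
    rw [mul_comm]
    gcongr
  have hJ0 (s : ℝ) (hs : x ≤ s) : |besselJnat n s| ≤ e :=
    abs_le_of_sq_le_sq (by nlinarith [hsq s hs, sq_nonneg (besselJnat (n + 1) s)]) (sqrt_nonneg _)
  have hJ1 (s : ℝ) (hs : x ≤ s) : |besselJnat (n + 1) s| ≤ e :=
    abs_le_of_sq_le_sq (by nlinarith [hsq s hs, sq_nonneg (besselJnat n s)]) (sqrt_nonneg _)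
  have hpi : 0 ≤ π / 2 := by positivity
  have hmv := (convex_Icc 0 (π / 2)).norm_image_sub_le_of_norm_hasDerivWithin_le
    (f := fun t => besselJnat n (x + t) * cos t + besselJnat (n + 1) (x + t) * sin t)
    (C := (2 * n + 1) * e / x)
    (fun t ht => (hasDerivAt_besselJnat_rotation n (x := x) (t := t)
      (by have := ht.1; positivity)).hasDerivWithinAt) (fun t ht => ?_)
    (Set.left_mem_Icc.2 hpi) (Set.right_mem_Icc.2 hpi)
  · simp only [cos_pi_div_two, sin_pi_div_two, cos_zero, sin_zero, mul_zero, mul_one, zero_add,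
      add_zero, sub_zero, Real.norm_eq_abs, abs_of_nonneg hpi] at hmv
    rw [sq_sub_sq, abs_mul]
    calc _ ≤ (e + e) * ((2 * n + 1) * e / x * (π / 2)) := by
          gcongr
          exact (abs_add_le _ _).trans (add_le_add (hJ1 _ (by linarith)) (hJ0 _ le_rfl))
      _ = π * (2 * n + 1) * e ^ 2 / x := by ring
      _ = π * (2 * n + 1) * B / x ^ 2 := by rw [he]; field_simp
  · have hxt : x ≤ x + t := by linarith [ht.1]
    rw [norm_div, Real.norm_of_nonneg (hx0.le.trans hxt), Real.norm_eq_abs]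
    have h0 : |besselJnat n (x + t) * cos t| ≤ e := by
      rw [abs_mul]
      nlinarith [hJ0 _ hxt, abs_cos_le_one t, abs_nonneg (besselJnat n (x + t)), abs_nonneg (cos t)]
    have h1 : |besselJnat (n + 1) (x + t) * sin t| ≤ e := by
      rw [abs_mul]
      nlinarith [hJ1 _ hxt, abs_sin_le_one t, abs_nonneg (besselJnat (n + 1) (x + t)),
        abs_nonneg (sin t)]
    gcongr
    refine (abs_sub _ _).trans ?_
    rw [abs_mul (n : ℝ), abs_mul ((n : ℝ) + 1), abs_of_nonneg (by positivity : (0 : ℝ) ≤ n),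
      abs_of_nonneg (by positivity : (0 : ℝ) ≤ n + 1)]
    nlinarith [mul_le_mul_of_nonneg_left h0 (by positivity : (0 : ℝ) ≤ n),
      mul_le_mul_of_nonneg_left h1 (by positivity : (0 : ℝ) ≤ n + 1)]

lemma exists_besselJnat_quarter_period_asymptotics : ∃ K : ℝ, 0 < K ∧ ∀ n : ℕ, ∃ C : ℝ, 0 ≤ C ∧
    ∀ x : ℝ, 1 ≤ x →
      |x * (besselJnat (n + 1) x ^ 2 + besselJnat (n + 1) (x + π / 2) ^ 2) - K| ≤ C / x := by
  obtain ⟨K, hK, h⟩ := exists_besselJnat_sq_asymptotics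
  refine ⟨K, hK, fun n => ?_⟩
  obtain ⟨C, hC, hn⟩ := h n
  have hB (x : ℝ) (hx : 1 ≤ x) :
      x * (besselJnat n x ^ 2 + besselJnat (n + 1) x ^ 2) ≤ K + C := by
    have : C / x ≤ C := div_le_self hC hx
    linarith [(abs_le.1 (hn x hx)).2]
  refine ⟨C + π * (2 * n + 1) * (K + C), by positivity, fun x hx => ?_⟩
  have hx0 : 0 < x := by linarith
  have hs := mul_le_mul_of_nonneg_left (abs_besselJnat_shift_sq_sub_sq_le hB x hx) hx0.le
  rw [show x * (besselJnat (n + 1) x ^ 2 + besselJnat (n + 1) (x + π / 2) ^ 2) - K =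
    (x * (besselJnat n x ^ 2 + besselJnat (n + 1) x ^ 2) - K) +
      x * (besselJnat (n + 1) (x + π / 2) ^ 2 - besselJnat n x ^ 2) by ring]
  refine (abs_add_le _ _).trans ?_
  rw [abs_mul x (_ - _), abs_of_pos hx0]
  refine (add_le_add (hn x hx) hs).trans_eq ?_
  field_simp

lemma exists_sum_besselJnat_sq_asymptotics : ∃ K : ℝ, 0 < K ∧ ∀ n l : ℕ, ∃ C : ℝ, 0 ≤ C ∧
    ∀ m : ℕ, 1 ≤ m → |m * ∑ j ∈ Finset.range (2 * n),
      besselJnat (l + 1) ((4 * (m : ℝ) + 2 * ((j : ℝ) + 1) + 1) * π / 4) ^ 2 - n * K| ≤ C / m := by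
  obtain ⟨K, hK, h⟩ := exists_besselJnat_quarter_period_asymptotics
  refine ⟨K / π, by positivity, fun n l => ?_⟩
  induction n with
  | zero => exact ⟨0, le_rfl, fun m _ => by simp⟩
  | succ n ih =>
    obtain ⟨C, hC, hn⟩ := ih
    obtain ⟨D, hD, hl⟩ := h l
    refine ⟨C + (D + K * (n + 1)), by positivity, fun m hm => ?_⟩
    have hm1 : (1 : ℝ) ≤ m := by exact_mod_cast hm
    have hm0 : (0 : ℝ) < m := by linarith
    set x : ℝ := (4 * (m : ℝ) + 2 * (((2 * n : ℕ) : ℝ) + 1) + 1) * π / 4 with hxdef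
    have hx' : (4 * (m : ℝ) + 2 * (((2 * n + 1 : ℕ) : ℝ) + 1) + 1) * π / 4 = x + π / 2 := by
      rw [hxdef]; push_cast; ring
    have hxm : x - m * π = (4 * n + 3) * π / 4 := by rw [hxdef]; push_cast; ring
    have hmx : (m : ℝ) ≤ x := by
      have : 0 ≤ (4 * (n : ℝ) + 3) * π / 4 := by positivity
      nlinarith [pi_gt_three]
    have hx1 : 1 ≤ x := hm1.trans hmx
    have hx0 : 0 < x := by linarith
    rw [show 2 * (n + 1) = 2 * n + 1 + 1 by ring, Finset.sum_range_succ, Finset.sum_range_succ,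
      hx', ← hxdef]
    have hp := hl x hx1
    set P := besselJnat (l + 1) x ^ 2 + besselJnat (l + 1) (x + π / 2) ^ 2
    have hpair : |m * P - K / π| ≤ (D + K * (n + 1)) / m := by
      have hsplit : m * P - K / π = m / x * (x * P - K) - K * ((4 * n + 3) / 4) / x := by
        have hmx' : (m : ℝ) = (x - (4 * n + 3) * π / 4) / π := by
          rw [← hxm]; field_simp; ring
        rw [hmx']
        field_simp
        ring
      rw [hsplit]
      refine (abs_sub _ _).trans ?_
      rw [add_div D]
      refine add_le_add ?_ ?_
      · rw [abs_mul, abs_of_pos (by positivity)]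
        calc _ ≤ 1 * (D / x) := by
              gcongr
              exact (div_le_one hx0).2 hmx
          _ ≤ D / m := by rw [one_mul]; gcongr
      · rw [abs_of_nonneg (by positivity)]
        gcongr
        linarith
    rw [show (m : ℝ) * (∑ j ∈ Finset.range (2 * n),
        besselJnat (l + 1) ((4 * (m : ℝ) + 2 * ((j : ℝ) + 1) + 1) * π / 4) ^ 2 +
        besselJnat (l + 1) x ^ 2 + besselJnat (l + 1) (x + π / 2) ^ 2) -
          ((n + 1 : ℕ) : ℝ) * (K / π) =
        (m * ∑ j ∈ Finset.range (2 * n),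
          besselJnat (l + 1) ((4 * (m : ℝ) + 2 * ((j : ℝ) + 1) + 1) * π / 4) ^ 2 - n * (K / π)) +
        (m * P - K / π) by simp only [P]; push_cast; ring]
    refine (abs_add_le _ _).trans ((add_le_add (hn m hm) hpair).trans_eq ?_)
    ring

lemma injective_and_condNumber_bounds {E F : Type*} [NormedAddCommGroup E] [NormedAddCommGroup F]
    [NormedSpace ℝ E] [NormedSpace ℝ F] [Nontrivial E] (A : E →ₗ[ℝ] F) {a b : ℝ} (ha : 0 < a)
    (hA : ∀ v, a * ‖v‖ ^ 2 ≤ ‖A v‖ ^ 2) (hB : ∀ v, ‖A v‖ ^ 2 ≤ b * ‖v‖ ^ 2) :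
    Function.Injective A ∧ 1 ≤ condNumber A ∧ condNumber A ≤ b / a := by
  obtain ⟨u, hu⟩ := exists_norm_eq E zero_le_one
  have hlow (v : E) (hv : ‖v‖ = 1) : √a ≤ ‖A v‖ := by
    rw [sqrt_le_left (norm_nonneg _)]
    simpa [hv] using hA v
  have hup (v : E) (hv : ‖v‖ = 1) : ‖A v‖ ≤ √b := by
    apply le_sqrt_of_sq_le
    simpa [hv] using hB v
  have hab : a ≤ b := by
    have h1 := hA u
    have h2 := hB u
    simp only [hu, one_pow, mul_one] at h1 h2
    exact h1.trans h2
  set S := (fun v => ‖A v‖) '' {v : E | ‖v‖ = 1}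
  have hne : S.Nonempty := ⟨_, u, hu, rfl⟩
  have hmin : √a ≤ sigmaMin A := le_csInf hne (by rintro _ ⟨v, hv, rfl⟩; exact hlow v hv)
  have hmax : sigmaMax A ≤ √b := csSup_le hne (by rintro _ ⟨v, hv, rfl⟩; exact hup v hv)
  have hmm : sigmaMin A ≤ sigmaMax A := csInf_le_csSup hne
    ⟨√a, by rintro _ ⟨v, hv, rfl⟩; exact hlow v hv⟩
    ⟨√b, by rintro _ ⟨v, hv, rfl⟩; exact hup v hv⟩
  have hsa : 0 < √a := sqrt_pos.2 ha
  refine ⟨(injective_iff_map_eq_zero A).2 fun v hv => ?_, ?_, ?_⟩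
  · have h := hA v
    rw [hv, norm_zero] at h
    have : ‖v‖ ^ 2 ≤ 0 := by nlinarith
    exact norm_eq_zero.1 (pow_eq_zero_iff two_ne_zero |>.1 (le_antisymm this (sq_nonneg _)))
  · exact (one_le_div (hsa.trans_le hmin)).2 hmm
  · calc condNumber A ≤ √b / √a := by
          rw [condNumber]
          gcongr
      _ = √(b / a) := (sqrt_div' b ha.le).symm
      _ ≤ b / a := by
          have h1 : 1 ≤ b / a := (one_le_div ha).2 hab
          rw [sqrt_le_left (by linarith)]
          nlinarith

lemma sum_exp_grid_eq_zero {M : ℕ} (hM : M ≠ 0) {k : ℤ} (hk : ¬ (M : ℤ) ∣ k) :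
    ∑ i : Fin M, Complex.exp ((k * (2 * π * (i : ℝ) / M) : ℝ) * Complex.I) = 0 := by
  have hMC : (M : ℂ) ≠ 0 := by exact_mod_cast hM
  set ζ := Complex.exp (k * (2 * π / M) * Complex.I)
  have hterm (i : ℕ) : Complex.exp ((k * (2 * π * (i : ℝ) / M) : ℝ) * Complex.I) = ζ ^ i := by
    rw [← Complex.exp_nat_mul]
    congr 1
    push_cast
    ring
  have hζM : ζ ^ M = 1 := by
    rw [← Complex.exp_nat_mul, Complex.exp_eq_one_iff]
    refine ⟨k, ?_⟩
    field_simp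
  have hζ : ζ ≠ 1 := by
    intro h
    obtain ⟨n, hn⟩ := Complex.exp_eq_one_iff.1 h
    apply hk
    refine ⟨n, ?_⟩
    have hpi : (π : ℂ) ≠ 0 := by exact_mod_cast pi_ne_zero
    have hI := Complex.I_ne_zero
    field_simp at hn
    have : (k : ℂ) = M * n := by linear_combination hn
    exact_mod_cast this
  simp only [hterm]
  rw [Fin.sum_univ_eq_sum_range (fun i => ζ ^ i) M, geom_sum_eq hζ, hζM, sub_self, zero_div]

lemma sum_cos_grid_eq_zero {M : ℕ} (hM : M ≠ 0) {k : ℤ} (hk : ¬ (M : ℤ) ∣ k) :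
    ∑ i : Fin M, cos (k * (2 * π * (i : ℝ) / M)) = 0 := by
  have h := congrArg Complex.re (sum_exp_grid_eq_zero hM hk)
  rw [Complex.re_sum] at h
  simpa only [Complex.exp_ofReal_mul_I_re, Complex.zero_re] using h

lemma sum_sin_grid_eq_zero {M : ℕ} (hM : M ≠ 0) (k : ℤ) :
    ∑ i : Fin M, sin (k * (2 * π * (i : ℝ) / M)) = 0 := by
  by_cases hk : (M : ℤ) ∣ k
  · obtain ⟨n, rfl⟩ := hk
    refine Finset.sum_eq_zero fun i _ => ?_
    have hM' : (M : ℝ) ≠ 0 := by exact_mod_cast hM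
    rw [show (((M : ℤ) * n : ℤ) : ℝ) * (2 * π * (i : ℝ) / M) = ((2 * n * i : ℤ) : ℝ) * π by
      push_cast; field_simp]
    exact sin_int_mul_pi _
  · have h := congrArg Complex.im (sum_exp_grid_eq_zero hM hk)
    rw [Complex.im_sum] at h
    simpa only [Complex.exp_ofReal_mul_I_im, Complex.zero_im] using h

/-- The trigonometric factor of `phaselessMatrix`. -/
noncomputable def trigFactor (N : ℕ) (q : Fin N × Fin 2) (i : Fin (2 * N + 1)) : ℝ :=
  if q.2 = 0 then cos ((q.1.1 + 1 : ℕ) * (2 * π * (i.1 : ℝ) / (2 * N + 1)))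
    else sin ((q.1.1 + 1 : ℕ) * (2 * π * (i.1 : ℝ) / (2 * N + 1)))

lemma sum_trigFactor_mul (N : ℕ) (q r : Fin N × Fin 2) :
    ∑ i, trigFactor N q i * trigFactor N r i = if q = r then (2 * N + 1 : ℝ) / 2 else 0 := by
  obtain ⟨l, c⟩ := q
  obtain ⟨l', c'⟩ := r
  have hM : 2 * N + 1 ≠ 0 := by omega
  set p : ℤ := (l.1 + 1) + (l'.1 + 1)
  set d : ℤ := (l.1 + 1) - (l'.1 + 1)
  have hp : ¬ ((2 * N + 1 : ℕ) : ℤ) ∣ p := by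
    intro h
    have := Int.le_of_dvd (by omega) h
    omega
  have hcp := sum_cos_grid_eq_zero hM hp
  have hcd : ∑ i : Fin (2 * N + 1), cos (d * (2 * π * (i : ℝ) / (2 * N + 1 : ℕ))) =
      if l = l' then (2 * N + 1 : ℝ) else 0 := by
    split_ifs with h
    · simp [d, h]
    · refine sum_cos_grid_eq_zero hM fun hd => h ?_
      have := Int.eq_zero_of_abs_lt_dvd hd (by rw [abs_lt]; omega)
      exact Fin.ext (by omega)
  have hsp := sum_sin_grid_eq_zero hM p
  have hsd := sum_sin_grid_eq_zero hM d
  push_cast at hcp hcd hsp hsd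
  have hpc : (p : ℝ) = (l.1 + 1) + (l'.1 + 1) := by simp [p]
  have hdc : (d : ℝ) = (l.1 + 1) - (l'.1 + 1) := by simp [d]
  simp only [hpc, hdc, add_mul ((l.1 : ℝ) + 1) ((l'.1 : ℝ) + 1), sub_mul, cos_add, cos_sub,
    sin_add, sin_sub, Finset.sum_add_distrib, Finset.sum_sub_distrib] at hcp hcd hsp hsd
  fin_cases c <;> fin_cases c' <;> simp [trigFactor, Prod.ext_iff] <;> split_ifs at * <;> linarith

lemma norm_sq_toEuclideanLin_of_gram_diagonal {ι κ : Type*} [Fintype ι] [Fintype κ] [DecidableEq κ]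
    (A : Matrix ι κ ℝ) (D : κ → ℝ) (h : ∀ q r, ∑ p, A p q * A p r = if q = r then D q else 0)
    (v : EuclideanSpace ℝ κ) :
    ‖Matrix.toEuclideanLin A v‖ ^ 2 = ∑ q, D q * v q ^ 2 := by
  rw [EuclideanSpace.norm_sq_eq]
  simp only [Matrix.toLpLin_apply, Matrix.mulVec, dotProduct, Real.norm_eq_abs, sq_abs]
  calc ∑ p, (∑ q, A p q * v q) ^ 2
      = ∑ p, ∑ q, ∑ r, v q * v r * (A p q * A p r) := by
        refine Finset.sum_congr rfl fun p _ => ?_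
        rw [sq, Finset.sum_mul_sum]
        refine Finset.sum_congr rfl fun q _ => Finset.sum_congr rfl fun r _ => ?_
        ring
    _ = ∑ q, ∑ r, v q * v r * ∑ p, A p q * A p r := by
        rw [Finset.sum_comm]
        refine Finset.sum_congr rfl fun q _ => ?_
        rw [Finset.sum_comm]
        simp only [Finset.mul_sum]
    _ = _ := by
        simp only [h, mul_ite, mul_zero, Finset.sum_ite_eq, Finset.mem_univ, if_true]
        refine Finset.sum_congr rfl fun q _ => ?_
        ring

/-- The sum over the wave numbers of the squared Bessel values of order `l + 1`. -/
noncomputable def besselSquareSum (N m l : ℕ) : ℝ :=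
  ∑ j ∈ Finset.range N, besselJnat (l + 1) ((4 * (m : ℝ) + 2 * ((j : ℝ) + 1) + 1) * π / 4) ^ 2

lemma norm_sq_phaselessMatrix (N m : ℕ) (v : EuclideanSpace ℝ (Fin N × Fin 2)) :
    ‖Matrix.toEuclideanLin (phaselessMatrix N m) v‖ ^ 2 =
      ∑ q, (2 * N + 1 : ℝ) / 2 * besselSquareSum N m q.1 * v q ^ 2 := by
  refine norm_sq_toEuclideanLin_of_gram_diagonal _ _ (fun q r => ?_) v
  set B : ℕ → ℕ → ℝ := fun l j =>
    besselJnat (l + 1) ((4 * (m : ℝ) + 2 * ((j : ℝ) + 1) + 1) * π / 4)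
  calc ∑ p, phaselessMatrix N m p q * phaselessMatrix N m p r
      = ∑ i, ∑ j : Fin N, (trigFactor N q i * trigFactor N r i) * (B q.1 j * B r.1 j) := by
        rw [Fintype.sum_prod_type]
        refine Finset.sum_congr rfl fun i _ => Finset.sum_congr rfl fun j _ => ?_
        simp only [phaselessMatrix, trigFactor, B]
        ring
    _ = (∑ i, trigFactor N q i * trigFactor N r i) * ∑ j : Fin N, B q.1 j * B r.1 j := by
        rw [Finset.sum_mul_sum]
    _ = _ := by
        rw [sum_trigFactor_mul]
        split_ifs with h
        · subst h
          simp only [← sq]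
          rw [Fin.sum_univ_eq_sum_range (fun j => B q.1 j ^ 2) N, besselSquareSum]
        · rw [zero_mul]

lemma exists_besselSquareSum_bounds {N : ℕ} (hN : 2 ≤ N) (hNeven : Even N) :
    ∃ c : ℝ, 0 < c ∧ ∃ M : ℝ, 0 < M ∧ ∀ m : ℕ, 1 ≤ m → ∀ l : Fin N,
      |m * besselSquareSum N m l - c| ≤ c * M / m := by
  obtain ⟨n, rfl⟩ := even_iff_exists_two_mul.1 hNeven
  obtain ⟨K, hK, h⟩ := exists_sum_besselJnat_sq_asymptotics
  choose C hC hb using h n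
  have hn : (0 : ℝ) < n := by exact_mod_cast (by omega : 0 < n)
  have hs : 0 ≤ ∑ l ∈ Finset.range (2 * n), C l := Finset.sum_nonneg fun l _ => hC l
  refine ⟨n * K, by positivity, (∑ l ∈ Finset.range (2 * n), C l + 1) / (n * K), by positivity,
    fun m hm l => (hb l m hm).trans ?_⟩
  rw [mul_div_cancel₀ _ (by positivity)]
  gcongr
  linarith [Finset.single_le_sum (f := C) (fun l _ => hC l) (Finset.mem_range.2 l.2)]

lemma exists_condNumber_phaselessMatrix_bounds {N : ℕ} (hN : 2 ≤ N) (hNeven : Even N) :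
    ∃ C : ℝ, 0 < C ∧ ∃ mstar : ℕ, 1 ≤ mstar ∧ ∀ m : ℕ, mstar ≤ m →
      Function.Injective (Matrix.toEuclideanLin (phaselessMatrix N m)) ∧
      1 ≤ condNumber (Matrix.toEuclideanLin (phaselessMatrix N m)) ∧
      condNumber (Matrix.toEuclideanLin (phaselessMatrix N m)) ≤ 1 + C / m := by
  obtain ⟨c, hc, M, hM, h⟩ := exists_besselSquareSum_bounds hN hNeven
  refine ⟨4 * M, by positivity, ⌈2 * M⌉₊ + 1, by omega, fun m hm => ?_⟩
  have hm1 : 1 ≤ m := by omega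
  have hm0 : (0 : ℝ) < m := by exact_mod_cast hm1
  have hmM : 2 * M ≤ m := (Nat.le_ceil _).trans (by exact_mod_cast (by omega))
  set t := M / m
  have ht0 : 0 < t := by positivity
  have ht : t ≤ 1 / 2 := by
    rw [div_le_iff₀ hm0]; linarith
  set w : ℝ := (2 * N + 1) / 2 * (c / m)
  have hw : 0 < w := by positivity
  have hbd (l : Fin N) : w * (1 - t) ≤ (2 * N + 1 : ℝ) / 2 * besselSquareSum N m l ∧
      (2 * N + 1 : ℝ) / 2 * besselSquareSum N m l ≤ w * (1 + t) := by
    have hl := h m hm1 l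
    rw [mul_div_assoc, abs_le] at hl
    rw [mul_assoc, mul_assoc]
    constructor <;> gcongr
    · rw [div_mul_eq_mul_div, div_le_iff₀ hm0]
      linarith [hl.1]
    · rw [div_mul_eq_mul_div, le_div_iff₀ hm0]
      linarith [hl.2]
  have : Nonempty (Fin N) := ⟨⟨0, by omega⟩⟩
  obtain ⟨hinj, h1, h2⟩ := injective_and_condNumber_bounds
    (Matrix.toEuclideanLin (phaselessMatrix N m)) (a := w * (1 - t)) (b := w * (1 + t))
    (mul_pos hw (by linarith))
    (fun v => by
      rw [norm_sq_phaselessMatrix, EuclideanSpace.norm_sq_eq, Finset.mul_sum]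
      simp only [Real.norm_eq_abs, sq_abs]
      exact Finset.sum_le_sum fun q _ => mul_le_mul_of_nonneg_right (hbd q.1).1 (sq_nonneg _))
    (fun v => by
      rw [norm_sq_phaselessMatrix, EuclideanSpace.norm_sq_eq, Finset.mul_sum]
      simp only [Real.norm_eq_abs, sq_abs]
      exact Finset.sum_le_sum fun q _ => mul_le_mul_of_nonneg_right (hbd q.1).2 (sq_nonneg _))
  refine ⟨hinj, h1, h2.trans ?_⟩
  rw [mul_div_mul_left _ _ hw.ne', div_le_iff₀ (by linarith), mul_div_assoc]
  nlinarith

/-- Theorem 7.1 of the paper: for the optimal phaseless measurement strategy, the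
measurement matrix `A(m₀)` is eventually injective with `κ(A(m₀)) ≤ 1 + C_N/m₀`;
hence `κ(A(m₀)) → 1` and the infimum of the condition numbers equals `1`. -/
theorem phaseless_condition_number (N : ℕ) (hN : 2 ≤ N) (hNeven : Even N) :
    ∃ C : ℝ, 0 < C ∧ ∃ mstar : ℕ, 1 ≤ mstar ∧
      (∀ m₀ : ℕ, mstar ≤ m₀ →
        Function.Injective (Matrix.toEuclideanLin (phaselessMatrix N m₀)) ∧
        condNumber (Matrix.toEuclideanLin (phaselessMatrix N m₀)) ≤ 1 + C / (m₀ : ℝ)) ∧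
      Filter.Tendsto (fun m₀ : ℕ => condNumber (Matrix.toEuclideanLin (phaselessMatrix N m₀)))
        Filter.atTop (nhds 1) ∧
      sInf {x : ℝ | ∃ m₀ : ℕ, mstar ≤ m₀ ∧
        x = condNumber (Matrix.toEuclideanLin (phaselessMatrix N m₀))} = 1 := by
  obtain ⟨C, hC, mstar, hmstar, h⟩ := exists_condNumber_phaselessMatrix_bounds hN hNeven
  have hlim : Filter.Tendsto
      (fun m₀ : ℕ => condNumber (Matrix.toEuclideanLin (phaselessMatrix N m₀)))
      Filter.atTop (nhds 1) := by
    have hub : Filter.Tendsto (fun m₀ : ℕ => 1 + C / (m₀ : ℝ)) Filter.atTop (nhds 1) := by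
      simpa using (tendsto_const_div_atTop_nhds_zero_nat C).const_add 1
    refine tendsto_of_tendsto_of_tendsto_of_le_of_le' tendsto_const_nhds hub ?_ ?_ <;>
      filter_upwards [Filter.eventually_ge_atTop mstar] with m hm
    exacts [(h m hm).2.1, (h m hm).2.2]
  refine ⟨C, hC, mstar, hmstar, fun m hm => ⟨(h m hm).1, (h m hm).2.2⟩, hlim, ?_⟩
  refine IsGLB.csInf_eq ⟨?_, fun b hb => ?_⟩ ⟨_, mstar, le_rfl, rfl⟩
  · rintro _ ⟨m, hm, rfl⟩
    exact (h m hm).2.1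
  · refine ge_of_tendsto hlim ?_
    filter_upwards [Filter.eventually_ge_atTop mstar] with m hm using hb ⟨m, hm, rfl⟩
end

section
/- Fix an even integer N ≥ 2. For each integer m₀ ≥ 1 set θ_I := 2πI/(2N+1) for I = 0,…,2N and x_J := (4m₀+2J+1)π/4 for J = 1,…,N, and let Ã(m₀) be the complex matrix with (2N+1)·N rows indexed by pairs (I,J) and 2N columns indexed by l ∈ {−N,…,−1,1,…,N}, whose entries are Ã[(I,J),l] := e^{i·l·θ_I}·J_l(x_J). Then there exist a constant C_N > 0 and an integer m* ≥ 1 such that for every m₀ ≥ m*, Ã(m₀) is injective as a ℂ-linear map and κ(Ã(m₀)) ≤ 1 + C_N/m₀; in particular κ(Ã(m₀)) → 1 as m₀ → ∞. -/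
open Real

/-- The nonzero integer order `l ∈ {−N,…,−1,1,…,N}` encoded by a pair
`(l', s) : Fin N × Bool`: `l = l'+1` if `s = true`, and `l = −(l'+1)` otherwise. -/
def colOrder {N : ℕ} (q : Fin N × Bool) : ℤ :=
  if q.2 then (q.1.1 + 1 : ℤ) else -(q.1.1 + 1 : ℤ)

/-- The phased (complex) linearized measurement matrix: rows indexed by `(I, J)` with
`I = 0,…,2N` and `J = 1,…,N`, columns indexed by the nonzero orders
`l ∈ {−N,…,−1,1,…,N}`, with entries `e^{ilθ_I}·J_l(x_J)`, where `θ_I = 2πI/(2N+1)`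
and `x_J = (4m₀+2J+1)π/4`. -/
noncomputable def phasedMatrix (N m₀ : ℕ) :
    Matrix ((Fin (2 * N + 1)) × Fin N) ((Fin N) × Bool) ℂ := fun p q =>
  Complex.exp (Complex.I * (colOrder q : ℂ) * ((2 * π * (p.1.1 : ℝ) / (2 * N + 1) : ℝ) : ℂ)) *
    (besselJ (colOrder q) ((4 * (m₀ : ℝ) + 2 * ((p.2.1 : ℝ) + 1) + 1) * π / 4) : ℂ)

section Moments

/-- The even moments `∫₀¹ s^(2j) (1 - s²)^a ds` of the Poisson weight. -/
noncomputable def poissonMoment (j : ℕ) (a : ℝ) : ℝ :=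
  ∫ s in (0 : ℝ)..1, s ^ (2 * j) * (1 - s ^ 2) ^ a

lemma continuous_poisson_weight {a : ℝ} (ha : 0 ≤ a) :
    Continuous fun s : ℝ => (1 - s ^ 2) ^ a :=
  (by fun_prop : Continuous fun s : ℝ => 1 - s ^ 2).rpow_const fun _ => Or.inr ha

lemma poissonMoment_by_parts (j : ℕ) {a : ℝ} (ha : 0 ≤ a) :
    (2 * j + 1) * poissonMoment j (a + 1) = 2 * (a + 1) * poissonMoment (j + 1) a := by
  have h1 := continuous_poisson_weight ha
  have h2 := continuous_poisson_weight (a := a + 1) (by linarith)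
  have hd : ∀ s : ℝ, HasDerivAt (fun s : ℝ => s ^ (2 * j + 1) * (1 - s ^ 2) ^ (a + 1))
      ((2 * j + 1) * (s ^ (2 * j) * (1 - s ^ 2) ^ (a + 1))
        - 2 * (a + 1) * (s ^ (2 * (j + 1)) * (1 - s ^ 2) ^ a)) s := by
    intro s
    have e1 : HasDerivAt (fun s : ℝ => 1 - s ^ 2) (-(2 * s)) s := by
      simpa using (hasDerivAt_pow 2 s).const_sub 1
    have e2 := e1.rpow_const (p := a + 1) (Or.inr (by linarith))
    refine ((hasDerivAt_pow (2 * j + 1) s).fun_mul e2).congr_deriv ?_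
    rw [show a + 1 - 1 = a by ring, show 2 * j + 1 - 1 = 2 * j by omega]
    push_cast
    ring
  have h := intervalIntegral.integral_eq_sub_of_hasDerivAt (a := 0) (b := 1)
    (fun s _ => hd s) (Continuous.intervalIntegrable (by fun_prop) _ _)
  rw [intervalIntegral.integral_sub (Continuous.intervalIntegrable (by fun_prop) _ _)
    (Continuous.intervalIntegrable (by fun_prop) _ _), intervalIntegral.integral_const_mul,
    intervalIntegral.integral_const_mul] at h
  have h0 : (0 : ℝ) ^ (a + 1) = 0 := Real.zero_rpow (by linarith)
  simp only [one_pow, sub_self, h0] at h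
  simp only [poissonMoment]
  simp at h
  linarith

lemma poissonMoment_add_one (j : ℕ) {a : ℝ} (ha : 0 ≤ a) :
    poissonMoment j (a + 1) = poissonMoment j a - poissonMoment (j + 1) a := by
  have h1 := continuous_poisson_weight ha
  simp only [poissonMoment]
  rw [← intervalIntegral.integral_sub (Continuous.intervalIntegrable (by fun_prop) _ _)
    (Continuous.intervalIntegrable (by fun_prop) _ _)]
  refine intervalIntegral.integral_congr fun s hs => ?_
  rw [Set.uIcc_of_le zero_le_one] at hs
  have : 0 ≤ 1 - s ^ 2 := by nlinarith [hs.1, hs.2]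
  rw [Real.rpow_add_one' this (by linarith)]
  ring

lemma poissonMoment_succ_left (j : ℕ) {a : ℝ} (ha : 0 ≤ a) :
    (2 * j + 2 * a + 3) * poissonMoment (j + 1) a = (2 * j + 1) * poissonMoment j a := by
  have h1 := poissonMoment_by_parts j ha
  rw [poissonMoment_add_one j ha] at h1
  linarith

lemma poissonMoment_zero_half : poissonMoment 0 (1 / 2) = π / 4 := by
  have h := integral_sqrt_one_sub_sq
  have hi : ∀ a b : ℝ, IntervalIntegrable (fun x : ℝ => √(1 - x ^ 2)) MeasureTheory.volume a b :=
    fun a b => Continuous.intervalIntegrable (by fun_prop) _ _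
  rw [← intervalIntegral.integral_add_adjacent_intervals (hi (-1) 0) (hi 0 1)] at h
  have h2 := intervalIntegral.integral_comp_neg (a := 0) (b := 1) fun x : ℝ => √(1 - x ^ 2)
  simp only [even_two.neg_pow, neg_zero] at h2
  simp only [poissonMoment, mul_zero, pow_zero, one_mul, ← Real.sqrt_eq_rpow]
  linarith

lemma poissonMoment_eq (j k : ℕ) :
    poissonMoment j (k + 1 / 2) = π / 2 * ((2 * j).factorial * (2 * (k + 1)).factorial) /
      (4 ^ (j + (k + 1)) * j.factorial * (k + 1).factorial * (j + (k + 1)).factorial) := by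
  induction j with
  | zero =>
    induction k with
    | zero =>
      norm_num [poissonMoment_zero_half]
    | succ k ih =>
      have h1 := poissonMoment_succ_left 0 (a := (k : ℝ) + 1 / 2) (by positivity)
      have h2 := poissonMoment_add_one 0 (a := (k : ℝ) + 1 / 2) (by positivity)
      have h3 : poissonMoment 0 (((k + 1 : ℕ) : ℝ) + 1 / 2) =
          (2 * k + 3) / (2 * k + 4) * poissonMoment 0 (k + 1 / 2) := by
        rw [show (((k + 1 : ℕ) : ℝ) + 1 / 2) = (k : ℝ) + 1 / 2 + 1 by push_cast; ring, h2]
        rw [div_mul_eq_mul_div, eq_div_iff (by positivity)]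
        push_cast at h1
        linarith
      rw [h3, ih, show 2 * (k + 1 + 1) = 2 * (k + 1) + 1 + 1 by ring,
        Nat.factorial_succ (2 * (k + 1) + 1), Nat.factorial_succ (2 * (k + 1)),
        show 0 + (k + 1 + 1) = (k + 1) + 1 by ring, Nat.factorial_succ (k + 1), zero_add]
      push_cast
      field_simp
      ring
  | succ j ih =>
    have h1 := poissonMoment_succ_left j (a := (k : ℝ) + 1 / 2) (by positivity)
    have h3 : poissonMoment (j + 1) ((k : ℝ) + 1 / 2) =
        (2 * j + 1) / (2 * j + 2 * k + 4) * poissonMoment j (k + 1 / 2) := by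
      rw [div_mul_eq_mul_div, eq_div_iff (by positivity)]
      linarith
    rw [h3, ih, show 2 * (j + 1) = 2 * j + 1 + 1 by ring,
      Nat.factorial_succ (2 * j + 1), Nat.factorial_succ (2 * j),
      show j + 1 + (k + 1) = (j + (k + 1)) + 1 by ring, Nat.factorial_succ (j + (k + 1)),
      Nat.factorial_succ j]
    push_cast
    field_simp
    ring

lemma hasSum_integral_cos_mul_weight (x : ℝ) {a : ℝ} (ha : 0 ≤ a) :
    HasSum (fun j : ℕ => (-1) ^ j * x ^ (2 * j) / (2 * j).factorial * poissonMoment j a)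
      (∫ s in (0 : ℝ)..1, Real.cos (x * s) * (1 - s ^ 2) ^ a) := by
  have h1 := continuous_poisson_weight ha
  have hsum : Summable fun j : ℕ => |x| ^ (2 * j) / (2 * j).factorial :=
    (Real.summable_pow_div_factorial |x|).comp_injective
      (mul_right_injective₀ (two_ne_zero : (2 : ℕ) ≠ 0))
  have key := intervalIntegral.hasSum_integral_of_dominated_convergence
    (μ := MeasureTheory.volume) (a := 0) (b := 1)
    (F := fun (j : ℕ) (s : ℝ) =>
      (-1) ^ j * x ^ (2 * j) / (2 * j).factorial * (s ^ (2 * j) * (1 - s ^ 2) ^ a))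
    (f := fun s => Real.cos (x * s) * (1 - s ^ 2) ^ a)
    (fun j _ => |x| ^ (2 * j) / (2 * j).factorial)
    (fun j => Continuous.aestronglyMeasurable (by fun_prop))
    (fun j => Filter.Eventually.of_forall fun s hs => ?_)
    (Filter.Eventually.of_forall fun s _ => hsum)
    (by simp)
    (Filter.Eventually.of_forall fun s _ => ?_)
  · simpa only [intervalIntegral.integral_const_mul, poissonMoment] using key
  · rw [Set.uIoc_of_le zero_le_one] at hs
    have h2 : 0 ≤ 1 - s ^ 2 := by nlinarith [hs.1, hs.2]
    have h3 : (1 - s ^ 2) ^ a ≤ 1 := Real.rpow_le_one h2 (by nlinarith [hs.1]) ha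
    have h4 : |s ^ (2 * j)| ≤ 1 := by
      rw [abs_pow]; exact pow_le_one₀ (abs_nonneg _) (abs_le.2 ⟨by linarith [hs.1], hs.2⟩)
    have h5 : 0 ≤ (1 - s ^ 2) ^ a := Real.rpow_nonneg h2 _
    rw [Real.norm_eq_abs, abs_mul, abs_div, abs_mul, abs_pow, abs_pow, abs_neg, abs_one, one_pow,
      one_mul, Nat.abs_cast, abs_mul, abs_of_nonneg h5]
    exact mul_le_of_le_one_right (by positivity) (mul_le_one₀ h4 h5 h3)
  · have := (Real.hasSum_cos (x * s)).mul_right ((1 - s ^ 2) ^ a)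
    refine this.congr_fun fun j => ?_
    rw [mul_pow]
    ring

/-- Poisson's integral representation of the Bessel functions of positive order. -/
lemma besselJnat_succ_eq_integral (k : ℕ) (x : ℝ) :
    besselJnat (k + 1) x = (2 * x) ^ (k + 1) * (k + 1).factorial * 2 /
      (π * (2 * (k + 1)).factorial) *
      ∫ s in (0 : ℝ)..1, Real.cos (x * s) * (1 - s ^ 2) ^ ((k : ℝ) + 1 / 2) := by
  have h := (hasSum_integral_cos_mul_weight x (a := (k : ℝ) + 1 / 2) (by positivity)).mul_left
    ((2 * x) ^ (k + 1) * (k + 1).factorial * 2 / (π * (2 * (k + 1)).factorial))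
  rw [← h.tsum_eq, besselJnat]
  refine tsum_congr fun j => ?_
  rw [poissonMoment_eq, show (4 : ℝ) ^ (j + (k + 1)) = 2 ^ (2 * j + (k + 1)) * 2 ^ (k + 1) by
    rw [show (4 : ℝ) = 2 ^ 2 by norm_num, ← pow_mul, ← pow_add]; congr 1; ring]
  rw [div_pow, mul_pow, pow_add x]
  field_simp

end Moments

section Asymptotics

lemma ofReal_mul_cpow_of_nonneg {y : ℝ} (hy : 0 ≤ y) {z : ℂ} (hz : z ≠ 0) {a : ℝ} (ha : a ≠ 0) :
    ((y : ℂ) * z) ^ (a : ℂ) = ((y ^ a : ℝ) : ℂ) * z ^ (a : ℂ) := by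
  have ha' : (a : ℂ) ≠ 0 := by exact_mod_cast ha
  rcases hy.eq_or_lt with rfl | hy
  · simp [Real.zero_rpow ha, Complex.zero_cpow ha']
  · have hy' : (y : ℂ) ≠ 0 := by exact_mod_cast hy.ne'
    rw [Complex.ofReal_cpow hy.le, Complex.cpow_def_of_ne_zero (mul_ne_zero hy' hz),
      Complex.cpow_def_of_ne_zero hy', Complex.cpow_def_of_ne_zero hz,
      Complex.log_ofReal_mul hy hz, add_mul, Complex.exp_add, Complex.ofReal_log hy.le]

/-- Cauchy's theorem on the unit square, applied to `(1 - z²)^a exp(ixz)`. -/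
lemma integral_cos_mul_weight_eq (x : ℝ) {a : ℝ} (ha : 0 < a) :
    ∫ s in (0 : ℝ)..1, Real.cos (x * s) * (1 - s ^ 2) ^ a =
      (∫ s in (0 : ℝ)..1, (1 - ((s : ℂ) + Complex.I) ^ 2) ^ (a : ℂ) *
        Complex.exp (Complex.I * x * (s + Complex.I))).re +
      (-Complex.I * Complex.exp (Complex.I * x) * ∫ y in (0 : ℝ)..1,
        ((y ^ a * Real.exp (-(x * y)) : ℝ) : ℂ) * (y - 2 * Complex.I) ^ (a : ℂ)).re := by
  set f : ℂ → ℂ := fun z => (1 - z ^ 2) ^ (a : ℂ) * Complex.exp (Complex.I * x * z) with hf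
  have hre : ∀ z : ℂ, (1 - z ^ 2).re = 1 - z.re ^ 2 + z.im ^ 2 := fun z => by
    simp [pow_two]; ring
  have hcont : ContinuousOn f (Set.uIcc (0 : ℂ).re (1 + Complex.I).re ×ℂ
      Set.uIcc (0 : ℂ).im (1 + Complex.I).im) := by
    intro z hz
    simp only [Complex.mem_reProdIm, Complex.zero_re, Complex.zero_im, Complex.add_re,
      Complex.one_re, Complex.I_re, Complex.add_im, Complex.one_im, Complex.I_im, add_zero,
      zero_add, Set.uIcc_of_le zero_le_one, Set.mem_Icc] at hz
    have h0 : 0 ≤ (1 - z ^ 2).re := by rw [hre]; nlinarith [hz.1.1, hz.1.2, sq_nonneg z.im]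
    have h1 : ContinuousAt (fun z : ℂ => (1 - z ^ 2) ^ (a : ℂ)) z :=
      ContinuousAt.comp (f := fun z : ℂ => 1 - z ^ 2)
        (Complex.continuousAt_cpow_const_of_re_pos (Or.inl h0) (by simpa using ha)) (by fun_prop)
    exact (h1.mul (by fun_prop)).continuousWithinAt
  have hdiff : DifferentiableOn ℂ f
      (Set.Ioo (min (0 : ℂ).re (1 + Complex.I).re) (max (0 : ℂ).re (1 + Complex.I).re) ×ℂ
        Set.Ioo (min (0 : ℂ).im (1 + Complex.I).im) (max (0 : ℂ).im (1 + Complex.I).im)) := by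
    intro z hz
    simp only [Complex.mem_reProdIm, Complex.zero_re, Complex.zero_im, Complex.add_re,
      Complex.one_re, Complex.I_re, Complex.add_im, Complex.one_im, Complex.I_im, add_zero,
      zero_add, min_eq_left zero_le_one, max_eq_right zero_le_one, Set.mem_Ioo] at hz
    have h0 : 0 < (1 - z ^ 2).re := by rw [hre]; nlinarith [hz.1.1, hz.1.2, sq_nonneg z.im]
    have h1 : DifferentiableAt ℂ (fun z : ℂ => (1 - z ^ 2) ^ (a : ℂ)) z :=
      DifferentiableAt.cpow_const (by fun_prop) (Or.inl h0)
    exact (h1.mul (by fun_prop)).differentiableWithinAt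
  have key := Complex.integral_boundary_rect_eq_zero_of_continuousOn_of_differentiableOn f 0
    (1 + Complex.I) hcont hdiff
  simp only [Complex.zero_re, Complex.zero_im, Complex.add_re, Complex.one_re, Complex.I_re,
    Complex.add_im, Complex.one_im, Complex.I_im, add_zero, zero_add, Complex.ofReal_zero,
    Complex.ofReal_one, zero_mul, one_mul, smul_eq_mul] at key
  have hbot : (∫ s in (0 : ℝ)..1, f s).re =
      ∫ s in (0 : ℝ)..1, Real.cos (x * s) * (1 - s ^ 2) ^ a := by
    have hint : IntervalIntegrable (fun s : ℝ => f s) MeasureTheory.volume 0 1 := by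
      refine ContinuousOn.intervalIntegrable (hcont.comp (by fun_prop) fun s hs => ?_)
      simpa [Complex.mem_reProdIm] using hs
    have := Complex.reCLM.intervalIntegral_comp_comm hint
    rw [Complex.reCLM_apply] at this
    rw [← this]
    refine intervalIntegral.integral_congr fun s hs => ?_
    rw [Set.uIcc_of_le zero_le_one] at hs
    have h2 : 0 ≤ 1 - s ^ 2 := by nlinarith [hs.1, hs.2]
    simp only [hf, Complex.reCLM_apply]
    rw [show (1 - (s : ℂ) ^ 2) = ((1 - s ^ 2 : ℝ) : ℂ) by push_cast; ring,
      ← Complex.ofReal_cpow h2, Complex.re_ofReal_mul,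
      show Complex.I * x * s = ((x * s : ℝ) : ℂ) * Complex.I by push_cast; ring,
      Complex.exp_ofReal_mul_I_re, mul_comm]
  have hleft : ∫ y in (0 : ℝ)..1, f (y * Complex.I) =
      ((∫ y in (0 : ℝ)..1, (1 + y ^ 2) ^ a * Real.exp (-(x * y)) : ℝ) : ℂ) := by
    rw [← intervalIntegral.integral_ofReal]
    refine intervalIntegral.integral_congr fun y _ => ?_
    simp only [hf]
    rw [show 1 - ((y : ℂ) * Complex.I) ^ 2 = ((1 + y ^ 2 : ℝ) : ℂ) by
        push_cast; rw [mul_pow, Complex.I_sq]; ring,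
      ← Complex.ofReal_cpow (by positivity),
      show Complex.I * x * (y * Complex.I) = ((-(x * y) : ℝ) : ℂ) by
        push_cast; linear_combination (x * y : ℂ) * Complex.I_sq, ← Complex.ofReal_exp,
      ← Complex.ofReal_mul]
  have hright : ∫ y in (0 : ℝ)..1, f (1 + y * Complex.I) =
      Complex.exp (Complex.I * x) * ∫ y in (0 : ℝ)..1,
        ((y ^ a * Real.exp (-(x * y)) : ℝ) : ℂ) * (y - 2 * Complex.I) ^ (a : ℂ) := by
    rw [← intervalIntegral.integral_const_mul]
    refine intervalIntegral.integral_congr fun y hy => ?_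
    rw [Set.uIcc_of_le zero_le_one] at hy
    have hz : (y : ℂ) - 2 * Complex.I ≠ 0 := fun h => by
      simpa using congrArg Complex.im h
    simp only [hf]
    rw [show 1 - (1 + (y : ℂ) * Complex.I) ^ 2 = y * (y - 2 * Complex.I) by
        linear_combination -(y : ℂ) ^ 2 * Complex.I_sq,
      ofReal_mul_cpow_of_nonneg hy.1 hz ha.ne',
      show Complex.I * x * (1 + y * Complex.I) = Complex.I * x + ((-(x * y) : ℝ) : ℂ) by
        push_cast; linear_combination (x * y : ℂ) * Complex.I_sq, Complex.exp_add,
      ← Complex.ofReal_exp]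
    push_cast
    ring
  rw [hleft, hright] at key
  have key' := congrArg Complex.re key
  rw [Complex.sub_re, Complex.add_re, Complex.sub_re, hbot, Complex.re_mul_ofReal,
    Complex.I_re, zero_mul, sub_zero, Complex.zero_re] at key'
  rw [neg_mul, neg_mul, Complex.neg_re, mul_assoc]
  simp only [hf] at key'
  linarith

lemma integrableOn_rpow_mul_exp_neg_mul {a x : ℝ} (ha : 0 < a) (hx : 0 < x) :
    MeasureTheory.IntegrableOn (fun y : ℝ => y ^ a * Real.exp (-(x * y))) (Set.Ioi 0) := by
  simpa [neg_mul] using integrableOn_rpow_mul_exp_neg_mul_rpow (p := 1) (s := a) (b := x)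
    (by linarith) one_pos hx

lemma integral_Ioi_rpow_mul_exp_neg_mul {a x : ℝ} (ha : 0 < a) (hx : 0 < x) :
    ∫ y in Set.Ioi (0 : ℝ), y ^ a * Real.exp (-(x * y)) = Real.Gamma (a + 1) / x ^ (a + 1) := by
  have := Real.integral_rpow_mul_exp_neg_mul_Ioi (a := a + 1) (r := x) (by linarith) hx
  rw [add_sub_cancel_right] at this
  rw [this, one_div, Real.inv_rpow hx.le]
  field_simp

lemma integral_rpow_mul_exp_neg_mul_le {a x : ℝ} (ha : 0 < a) (hx : 0 < x) :
    ∫ y in (0 : ℝ)..1, y ^ a * Real.exp (-(x * y)) ≤ Real.Gamma (a + 1) / x ^ (a + 1) := by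
  rw [← integral_Ioi_rpow_mul_exp_neg_mul ha hx, intervalIntegral.integral_of_le zero_le_one]
  refine MeasureTheory.setIntegral_mono_set (integrableOn_rpow_mul_exp_neg_mul ha hx) ?_
    Set.Ioc_subset_Ioi_self.eventuallyLE
  filter_upwards [MeasureTheory.self_mem_ae_restrict measurableSet_Ioi] with y hy
  exact mul_nonneg (Real.rpow_nonneg (le_of_lt hy) _) (Real.exp_pos _).le

lemma abs_integral_rpow_mul_exp_sub_le {a x : ℝ} (ha : 0 < a) (hx : 0 < x) :
    |(∫ y in (0 : ℝ)..1, y ^ a * Real.exp (-(x * y))) - Real.Gamma (a + 1) / x ^ (a + 1)| ≤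
      Real.Gamma (a + 2) / x ^ (a + 2) := by
  have h1 := integrableOn_rpow_mul_exp_neg_mul ha hx
  have h2 := integrableOn_rpow_mul_exp_neg_mul (a := a + 1) (by linarith) hx
  have hsub : Set.Ioi (1 : ℝ) ⊆ Set.Ioi 0 := Set.Ioi_subset_Ioi zero_le_one
  have hsplit := MeasureTheory.setIntegral_union (μ := MeasureTheory.volume)
    (Set.Ioc_disjoint_Ioi (le_refl (1 : ℝ)) (a := 0))
    measurableSet_Ioi (h1.mono_set Set.Ioc_subset_Ioi_self) (h1.mono_set hsub)
  rw [Set.Ioc_union_Ioi_eq_Ioi zero_le_one, integral_Ioi_rpow_mul_exp_neg_mul ha hx,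
    ← intervalIntegral.integral_of_le zero_le_one] at hsplit
  rw [hsplit, sub_add_cancel_left, abs_neg, abs_of_nonneg (MeasureTheory.setIntegral_nonneg
    measurableSet_Ioi fun y hy => mul_nonneg (Real.rpow_nonneg (le_of_lt (hsub hy)) _)
      (Real.exp_pos _).le)]
  have h3 := integral_Ioi_rpow_mul_exp_neg_mul (a := a + 1) (by linarith) hx
  rw [show a + 1 + 1 = a + 2 by ring] at h3
  rw [← h3]
  refine (MeasureTheory.setIntegral_mono_on (h1.mono_set hsub) (h2.mono_set hsub)
    measurableSet_Ioi fun y hy => ?_).trans (MeasureTheory.setIntegral_mono_set h2 ?_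
      hsub.eventuallyLE)
  · exact mul_le_mul_of_nonneg_right
      (Real.rpow_le_rpow_of_exponent_le (le_of_lt hy) (by linarith)) (Real.exp_pos _).le
  · filter_upwards [MeasureTheory.self_mem_ae_restrict measurableSet_Ioi] with y hy
    exact mul_nonneg (Real.rpow_nonneg (le_of_lt hy) _) (Real.exp_pos _).le

lemma norm_cpow_sub_two_I_sub_le {a : ℝ} (ha : 0 < a) {y : ℝ} (hy : y ∈ Set.Icc (0 : ℝ) 1) :
    ‖((y : ℂ) - 2 * Complex.I) ^ (a : ℂ) - (-2 * Complex.I) ^ (a : ℂ)‖ ≤ a * 3 ^ a * y := by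
  have hd : ∀ t ∈ Set.Icc (0 : ℝ) 1, HasDerivWithinAt
      (fun t : ℝ => ((t : ℂ) - 2 * Complex.I) ^ (a : ℂ))
      (a * ((t : ℂ) - 2 * Complex.I) ^ ((a : ℂ) - 1)) (Set.Icc 0 1) t := by
    intro t _
    have h1 : HasDerivAt (fun z : ℂ => (z - 2 * Complex.I) ^ (a : ℂ))
        (a * ((t : ℂ) - 2 * Complex.I) ^ ((a : ℂ) - 1) * 1) t :=
      ((hasDerivAt_id (t : ℂ)).sub_const _).cpow_const (Or.inr (by simp))
    simpa using h1.comp_ofReal.hasDerivWithinAt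
  have hb : ∀ t ∈ Set.Icc (0 : ℝ) 1,
      ‖(a : ℂ) * ((t : ℂ) - 2 * Complex.I) ^ ((a : ℂ) - 1)‖ ≤ a * 3 ^ a := by
    intro t ht
    have h1 : ‖(t : ℂ) - 2 * Complex.I‖ ≤ 3 := by
      refine (norm_sub_le _ _).trans ?_
      simp [abs_of_nonneg ht.1]
      linarith [ht.2]
    have h2 : 1 ≤ ‖(t : ℂ) - 2 * Complex.I‖ := by
      refine le_trans ?_ (Complex.abs_im_le_norm _)
      simp
    rw [norm_mul, Complex.norm_real, Real.norm_eq_abs, abs_of_pos ha,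
      show (a : ℂ) - 1 = ((a - 1 : ℝ) : ℂ) by push_cast; ring, Complex.norm_cpow_real]
    gcongr
    exact (Real.rpow_le_rpow_of_exponent_le h2 (by linarith)).trans
      (Real.rpow_le_rpow (by linarith) h1 ha.le)
  have := (convex_Icc (0 : ℝ) 1).norm_image_sub_le_of_norm_hasDerivWithin_le hd hb
    (Set.left_mem_Icc.2 zero_le_one) hy
  simpa [abs_of_nonneg hy.1] using this

lemma exp_neg_le_rpow_div_rpow {b x : ℝ} (hb : 0 < b) (hx : 0 < x) :
    Real.exp (-x) ≤ b ^ b / x ^ b := by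
  have h1 : x ≤ b * Real.exp (x / b) := by
    have := Real.add_one_le_exp (x / b)
    have h2 : x = b * (x / b) := by field_simp
    nlinarith
  have h2 := Real.rpow_le_rpow hx.le h1 hb.le
  rw [Real.mul_rpow hb.le (Real.exp_pos _).le, ← Real.exp_mul, div_mul_cancel₀ _ hb.ne'] at h2
  rw [le_div_iff₀ (by positivity), Real.exp_neg, inv_mul_le_iff₀ (Real.exp_pos _)]
  linarith

lemma exists_abs_integral_cos_mul_weight_sub_le {a : ℝ} (ha : 0 < a) :
    ∃ C : ℝ, ∀ x : ℝ, 0 < x →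
      |(∫ s in (0 : ℝ)..1, Real.cos (x * s) * (1 - s ^ 2) ^ a) -
        2 ^ a * Real.cos (x - (a + 1) * (π / 2)) * (Real.Gamma (a + 1) / x ^ (a + 1))| ≤
        C / x ^ (a + 2) := by
  refine ⟨5 ^ a * (a + 2) ^ (a + 2) +
    (a * 3 ^ a * Real.Gamma (a + 2) + 2 ^ a * Real.Gamma (a + 2)), fun x hx => ?_⟩
  set T := ∫ s in (0 : ℝ)..1, (1 - ((s : ℂ) + Complex.I) ^ 2) ^ (a : ℂ) *
        Complex.exp (Complex.I * x * (s + Complex.I)) with hT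
  set R := ∫ y in (0 : ℝ)..1,
    ((y ^ a * Real.exp (-(x * y)) : ℝ) : ℂ) * (y - 2 * Complex.I) ^ (a : ℂ) with hR
  set G := ∫ y in (0 : ℝ)..1, y ^ a * Real.exp (-(x * y)) with hG
  have hcw : Continuous fun y : ℝ => y ^ a := continuous_id.rpow_const fun _ => Or.inr ha.le
  have hcw' : Continuous fun y : ℝ => y ^ (a + 1) :=
    continuous_id.rpow_const fun _ => Or.inr (by linarith)
  have hTb : ‖T‖ ≤ 5 ^ a * (a + 2) ^ (a + 2) / x ^ (a + 2) := by
    have h1 : ‖T‖ ≤ 5 ^ a * Real.exp (-x) * |(1 : ℝ) - 0| := by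
      refine intervalIntegral.norm_integral_le_of_norm_le_const fun s hs => ?_
      rw [Set.uIoc_of_le zero_le_one] at hs
      rw [norm_mul, Complex.norm_cpow_real, Complex.norm_exp]
      have h2 : ‖(s : ℂ) + Complex.I‖ ≤ 2 := by
        refine (norm_add_le _ _).trans ?_
        simp [abs_of_pos hs.1]
        linarith [hs.2]
      have h3 : ‖1 - ((s : ℂ) + Complex.I) ^ 2‖ ≤ 5 := by
        refine (norm_sub_le _ _).trans ?_
        rw [norm_one, norm_pow]
        nlinarith [norm_nonneg ((s : ℂ) + Complex.I)]
      have h4 : (Complex.I * x * (s + Complex.I)).re = -x := by simp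
      rw [h4]
      gcongr
    have h2 := exp_neg_le_rpow_div_rpow (b := a + 2) (by linarith) hx
    rw [sub_zero, abs_one, mul_one] at h1
    rw [mul_div_assoc]
    exact h1.trans (by gcongr)
  have hRb : ‖R - (-2 * Complex.I) ^ (a : ℂ) * G‖ ≤
      a * 3 ^ a * Real.Gamma (a + 2) / x ^ (a + 2) := by
    have hci : IntervalIntegrable (fun y : ℝ => ((y ^ a * Real.exp (-(x * y)) : ℝ) : ℂ) *
        (y - 2 * Complex.I) ^ (a : ℂ)) MeasureTheory.volume 0 1 := by
      refine Continuous.intervalIntegrable (Continuous.mul (by fun_prop) ?_) _ _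
      refine continuous_iff_continuousAt.2 fun y => ?_
      exact ContinuousAt.cpow (by fun_prop) (by fun_prop) (Or.inr (by simp))
    have h1 : R - (-2 * Complex.I) ^ (a : ℂ) * G = ∫ y in (0 : ℝ)..1,
        ((y ^ a * Real.exp (-(x * y)) : ℝ) : ℂ) *
          ((y - 2 * Complex.I) ^ (a : ℂ) - (-2 * Complex.I) ^ (a : ℂ)) := by
      rw [hG, ← intervalIntegral.integral_ofReal, ← intervalIntegral.integral_const_mul, hR,
        ← intervalIntegral.integral_sub hci (Continuous.intervalIntegrable (by fun_prop) _ _)]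
      refine intervalIntegral.integral_congr fun y _ => ?_
      ring
    have h2 : ‖R - (-2 * Complex.I) ^ (a : ℂ) * G‖ ≤
        ∫ y in (0 : ℝ)..1, a * 3 ^ a * (y ^ (a + 1) * Real.exp (-(x * y))) := by
      rw [h1]
      refine intervalIntegral.norm_integral_le_of_norm_le zero_le_one
        (Filter.Eventually.of_forall fun y hy => ?_)
        (Continuous.intervalIntegrable (by fun_prop) _ _)
      have h3 := norm_cpow_sub_two_I_sub_le ha (y := y) ⟨hy.1.le, hy.2⟩
      have h4 : 0 ≤ y ^ a * Real.exp (-(x * y)) :=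
        mul_nonneg (Real.rpow_nonneg hy.1.le _) (Real.exp_pos _).le
      rw [norm_mul, Complex.norm_real, Real.norm_eq_abs, abs_of_nonneg h4,
        Real.rpow_add_one hy.1.ne']
      calc _ ≤ y ^ a * Real.exp (-(x * y)) * (a * 3 ^ a * y) := by gcongr
        _ = _ := by ring
    rw [intervalIntegral.integral_const_mul] at h2
    have h5 := integral_rpow_mul_exp_neg_mul_le (a := a + 1) (by linarith) hx
    rw [show a + 1 + 1 = a + 2 by ring] at h5
    rw [mul_div_assoc]
    exact h2.trans (by gcongr)
  have hGb := abs_integral_rpow_mul_exp_sub_le ha hx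
  rw [← hG] at hGb
  have hphase : (-Complex.I * Complex.exp (Complex.I * x) * (-2 * Complex.I) ^ (a : ℂ)).re =
      2 ^ a * Real.cos (x - (a + 1) * (π / 2)) := by
    have h1 : (-2 * Complex.I) ^ (a : ℂ) =
        ((2 ^ a : ℝ) : ℂ) * Complex.exp (-(π / 2) * Complex.I * a) := by
      rw [show (-2 * Complex.I) = ((2 : ℝ) : ℂ) * (-Complex.I) by push_cast; ring,
        ofReal_mul_cpow_of_nonneg zero_le_two (by simp) ha.ne',
        Complex.cpow_def_of_ne_zero (x := -Complex.I) (by simp), Complex.log_neg_I]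
    have h2 : -Complex.I = Complex.exp (-(π / 2) * Complex.I) := by
      rw [← Complex.log_neg_I, Complex.exp_log (by simp)]
    rw [h1]
    nth_rewrite 1 [h2]
    rw [mul_left_comm, ← Complex.exp_add, ← Complex.exp_add, Complex.re_ofReal_mul,
      ← Complex.exp_ofReal_mul_I_re]
    congr 3
    push_cast
    ring
  have hphase_le : |2 ^ a * Real.cos (x - (a + 1) * (π / 2))| ≤ 2 ^ a := by
    rw [abs_mul, abs_of_nonneg (by positivity : (0 : ℝ) ≤ 2 ^ a)]
    exact mul_le_of_le_one_right (by positivity) (Real.abs_cos_le_one _)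
  have hdecomp : (-Complex.I * Complex.exp (Complex.I * x) * R).re =
      (-Complex.I * Complex.exp (Complex.I * x) * (R - (-2 * Complex.I) ^ (a : ℂ) * G)).re +
      2 ^ a * Real.cos (x - (a + 1) * (π / 2)) * G := by
    rw [← hphase, ← Complex.re_mul_ofReal, ← Complex.add_re]
    congr 1
    ring
  have hRre : |(-Complex.I * Complex.exp (Complex.I * x) *
      (R - (-2 * Complex.I) ^ (a : ℂ) * G)).re| ≤
      a * 3 ^ a * Real.Gamma (a + 2) / x ^ (a + 2) := by
    refine (Complex.abs_re_le_norm _).trans ?_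
    rw [norm_mul, norm_mul, norm_neg, Complex.norm_I, Complex.norm_exp]
    simpa using hRb
  rw [integral_cos_mul_weight_eq x ha, ← hT, ← hR, hdecomp]
  calc |T.re + ((-Complex.I * Complex.exp (Complex.I * x) *
          (R - (-2 * Complex.I) ^ (a : ℂ) * G)).re +
          2 ^ a * Real.cos (x - (a + 1) * (π / 2)) * G) -
          2 ^ a * Real.cos (x - (a + 1) * (π / 2)) * (Real.Gamma (a + 1) / x ^ (a + 1))|
      = |T.re + ((-Complex.I * Complex.exp (Complex.I * x) *
          (R - (-2 * Complex.I) ^ (a : ℂ) * G)).re +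
          2 ^ a * Real.cos (x - (a + 1) * (π / 2)) *
            (G - Real.Gamma (a + 1) / x ^ (a + 1)))| := by congr 1; ring
    _ ≤ |T.re| + (|(-Complex.I * Complex.exp (Complex.I * x) *
          (R - (-2 * Complex.I) ^ (a : ℂ) * G)).re| +
          |2 ^ a * Real.cos (x - (a + 1) * (π / 2))| *
            |G - Real.Gamma (a + 1) / x ^ (a + 1)|) := by
        rw [← abs_mul]
        exact (abs_add_le _ _).trans (by gcongr; exact abs_add_le _ _)
    _ ≤ 5 ^ a * (a + 2) ^ (a + 2) / x ^ (a + 2) +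
          (a * 3 ^ a * Real.Gamma (a + 2) / x ^ (a + 2) +
            2 ^ a * (Real.Gamma (a + 2) / x ^ (a + 2))) := by
        gcongr
        exact (Complex.abs_re_le_norm _).trans hTb
    _ = _ := by ring

lemma Gamma_nat_add_half_eq_factorial (n : ℕ) :
    Real.Gamma (n + 1 / 2) = √π * (2 * n).factorial / (4 ^ n * n.factorial) := by
  induction n with
  | zero => simp [← Real.Gamma_one_half_eq]
  | succ n ih =>
    rw [show ((n + 1 : ℕ) : ℝ) + 1 / 2 = (n + 1 / 2) + 1 by push_cast; ring,
      Real.Gamma_add_one (by positivity), ih, show 2 * (n + 1) = 2 * n + 1 + 1 by ring,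
      Nat.factorial_succ (2 * n + 1), Nat.factorial_succ (2 * n), Nat.factorial_succ n]
    push_cast
    field_simp
    ring

/-- Leading-order asymptotics of the Bessel functions of positive order. -/
lemma exists_abs_sqrt_mul_besselJnat_sub_le (k : ℕ) :
    ∃ C : ℝ, ∀ x : ℝ, 0 < x →
      |√x * besselJnat (k + 1) x - √(2 / π) * Real.cos (x - ((k + 1 : ℕ) : ℝ) * (π / 2) - π / 4)| ≤
        C / x := by
  have ha : (0 : ℝ) < k + 1 / 2 := by positivity
  obtain ⟨C, hC⟩ := exists_abs_integral_cos_mul_weight_sub_le ha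
  set c : ℝ := 2 ^ (k + 1) * (k + 1).factorial * 2 / (π * (2 * (k + 1)).factorial) with hc
  have hc0 : 0 < c := by positivity
  refine ⟨c * C, fun x hx => ?_⟩
  have hpow : √x * x ^ (k + 1) = x ^ ((k : ℝ) + 1 / 2 + 1) := by
    rw [Real.sqrt_eq_rpow, ← Real.rpow_natCast, ← Real.rpow_add hx]
    congr 1; push_cast; ring
  have hpow2 : x ^ ((k : ℝ) + 1 / 2 + 2) = x ^ ((k : ℝ) + 1 / 2 + 1) * x := by
    rw [← Real.rpow_add_one hx.ne']; congr 1; ring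
  have hx0 : 0 < x ^ ((k : ℝ) + 1 / 2 + 1) := by positivity
  have hamp : c * (2 ^ ((k : ℝ) + 1 / 2) * Real.Gamma ((k : ℝ) + 1 / 2 + 1)) = √(2 / π) := by
    have hG := Gamma_nat_add_half_eq_factorial (k + 1)
    rw [show ((k + 1 : ℕ) : ℝ) + 1 / 2 = (k : ℝ) + 1 / 2 + 1 by push_cast; ring] at hG
    rw [hG, Real.rpow_add two_pos, Real.rpow_natCast, ← Real.sqrt_eq_rpow,
      Real.sqrt_div zero_le_two, hc, show (4 : ℝ) = 2 * 2 by norm_num, mul_pow]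
    have hp : √π * √π = π := Real.mul_self_sqrt Real.pi_pos.le
    field_simp
    rw [pow_two, hp, pow_succ]
    ring
  have h := hC x hx
  set K := ∫ s in (0 : ℝ)..1, Real.cos (x * s) * (1 - s ^ 2) ^ ((k : ℝ) + 1 / 2) with hK
  have hJ : √x * besselJnat (k + 1) x = c * x ^ ((k : ℝ) + 1 / 2 + 1) * K := by
    rw [besselJnat_succ_eq_integral, ← hK, ← hpow, hc, mul_pow]
    ring
  have hph : x - ((k + 1 : ℕ) : ℝ) * (π / 2) - π / 4 = x - ((k : ℝ) + 1 / 2 + 1) * (π / 2) := by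
    push_cast; ring
  rw [hJ, hph, ← hamp]
  have hfac : c * x ^ ((k : ℝ) + 1 / 2 + 1) * K -
      c * (2 ^ ((k : ℝ) + 1 / 2) * Real.Gamma ((k : ℝ) + 1 / 2 + 1)) *
        Real.cos (x - ((k : ℝ) + 1 / 2 + 1) * (π / 2)) =
      c * x ^ ((k : ℝ) + 1 / 2 + 1) * (K - 2 ^ ((k : ℝ) + 1 / 2) *
        Real.cos (x - ((k : ℝ) + 1 / 2 + 1) * (π / 2)) *
        (Real.Gamma ((k : ℝ) + 1 / 2 + 1) / x ^ ((k : ℝ) + 1 / 2 + 1))) := by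
    generalize x ^ ((k : ℝ) + 1 / 2 + 1) = X at *
    field_simp
  rw [hfac, abs_mul, abs_of_pos (mul_pos hc0 hx0)]
  calc _ ≤ c * x ^ ((k : ℝ) + 1 / 2 + 1) * (C / x ^ ((k : ℝ) + 1 / 2 + 2)) := by gcongr
    _ = _ := by
      rw [hpow2]
      generalize x ^ ((k : ℝ) + 1 / 2 + 1) = X at *
      field_simp

end Asymptotics

section Sampling

/-- The sample point `(4m + 2J + 1)π/4` with the zero-based index `i = J - 1`. -/
noncomputable def samplePoint (m i : ℕ) : ℝ := (4 * (m : ℝ) + 2 * ((i : ℝ) + 1) + 1) * π / 4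

lemma cos_sq_samplePoint (m i k : ℕ) :
    Real.cos (samplePoint m i - ((k + 1 : ℕ) : ℝ) * (π / 2) - π / 4) ^ 2 =
      (1 + (-1) ^ (i + k)) / 2 := by
  rw [Real.cos_sq]
  have h : 2 * (samplePoint m i - ((k + 1 : ℕ) : ℝ) * (π / 2) - π / 4) =
      ((i + k : ℕ) : ℝ) * π + (((m : ℤ) - k : ℤ) : ℝ) * (2 * π) := by
    simp only [samplePoint]
    push_cast
    ring
  rw [h, Real.cos_add_int_mul_two_pi, Real.cos_nat_mul_pi]
  ring

lemma exists_abs_mul_besselJnat_sq_sub_le (i k : ℕ) :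
    ∃ K : ℝ, ∀ m : ℕ, 1 ≤ m →
      |m * besselJnat (k + 1) (samplePoint m i) ^ 2 - (1 + (-1) ^ (i + k)) / π ^ 2| ≤ K / m := by
  obtain ⟨C, hC⟩ := exists_abs_sqrt_mul_besselJnat_sub_le k
  have hC0 : 0 ≤ C := by simpa using (abs_nonneg _).trans (hC 1 one_pos)
  refine ⟨C ^ 2 + 2 * C + (2 * i + 3), fun m hm => ?_⟩
  have hπ : 3 < π := Real.pi_gt_three
  have hm' : (1 : ℝ) ≤ m := by exact_mod_cast hm
  set x := samplePoint m i with hx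
  have hxm : x = m * π + (2 * i + 3) * π / 4 := by simp only [hx, samplePoint]; ring
  have hi : (0 : ℝ) ≤ i := Nat.cast_nonneg i
  have hmx : m * π ≤ x := by rw [hxm]; linarith [show 0 ≤ (2 * (i : ℝ) + 3) * π / 4 by positivity]
  have hmx1 : (m : ℝ) ≤ x := by nlinarith
  have hx0 : 0 < x := by linarith
  set v := √(2 / π) * Real.cos (x - ((k + 1 : ℕ) : ℝ) * (π / 2) - π / 4) with hv
  set u := √x * besselJnat (k + 1) x with hu
  have huv : |u - v| ≤ C / x := hC x hx0
  have hv2 : v ^ 2 = (1 + (-1) ^ (i + k)) / π := by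
    rw [hv, mul_pow, Real.sq_sqrt (by positivity), hx, cos_sq_samplePoint]
    ring
  have hv1 : v ^ 2 ≤ 1 := by
    rw [hv, mul_pow, Real.sq_sqrt (by positivity)]
    refine mul_le_one₀ ?_ (sq_nonneg _) (Real.cos_sq_le_one _)
    rw [div_le_one (by positivity)]
    linarith
  have hu2 : u ^ 2 = x * besselJnat (k + 1) x ^ 2 := by rw [hu, mul_pow, Real.sq_sqrt hx0.le]
  have hCx : C / x ≤ C := div_le_self hC0 (by linarith)
  have hdiff : |u ^ 2 - v ^ 2| ≤ (C ^ 2 + 2 * C) / x := by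
    have h1 : u ^ 2 - v ^ 2 = (u - v) * ((u - v) + 2 * v) := by ring
    have h2 : |v| ≤ 1 := by rwa [← sq_le_one_iff_abs_le_one]
    have h3 : |(u - v) + 2 * v| ≤ C + 2 := by
      refine (abs_add_le _ _).trans ?_
      rw [abs_mul, abs_two]
      linarith
    rw [h1, abs_mul]
    calc _ ≤ C / x * (C + 2) := by gcongr
      _ = _ := by ring
  have hsplit : m * besselJnat (k + 1) x ^ 2 - (1 + (-1) ^ (i + k)) / π ^ 2 =
      m / x * (u ^ 2 - v ^ 2) - v ^ 2 * ((2 * i + 3) / 4 / x) := by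
    have h1 : (1 + (-1 : ℝ) ^ (i + k)) / π ^ 2 = v ^ 2 / π := by rw [hv2]; field_simp
    rw [h1, hu2]
    field_simp
    rw [hxm]
    ring
  rw [hsplit]
  have hmx2 : m / x ≤ 1 := by rw [div_le_one hx0]; exact hmx1
  calc |m / x * (u ^ 2 - v ^ 2) - v ^ 2 * ((2 * i + 3) / 4 / x)|
      ≤ |m / x * (u ^ 2 - v ^ 2)| + |v ^ 2 * ((2 * i + 3) / 4 / x)| := abs_sub _ _
    _ = m / x * |u ^ 2 - v ^ 2| + v ^ 2 * ((2 * i + 3) / 4 / x) := by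
        rw [abs_mul, abs_of_nonneg (by positivity : 0 ≤ m / x),
          abs_of_nonneg (by positivity : 0 ≤ v ^ 2 * ((2 * (i : ℝ) + 3) / 4 / x))]
    _ ≤ 1 * ((C ^ 2 + 2 * C) / x) + 1 * ((2 * i + 3) / x) := by
        gcongr
        linarith
    _ = (C ^ 2 + 2 * C + (2 * i + 3)) / x := by ring
    _ ≤ _ := by gcongr

/-- The squared length of the samples of the Bessel function of order `k + 1`. -/
noncomputable def sampleEnergy (N m k : ℕ) : ℝ :=
  ∑ i : Fin N, besselJnat (k + 1) (samplePoint m i) ^ 2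

lemma exists_abs_mul_sampleEnergy_sub_le {N : ℕ} (hN : Even N) (k : ℕ) :
    ∃ K : ℝ, ∀ m : ℕ, 1 ≤ m → |m * sampleEnergy N m k - N / π ^ 2| ≤ K / m := by
  choose K hK using fun i : Fin N => exists_abs_mul_besselJnat_sq_sub_le i k
  refine ⟨∑ i, K i, fun m hm => ?_⟩
  have hsum : ∑ i : Fin N, (1 + (-1 : ℝ) ^ ((i : ℕ) + k)) / π ^ 2 = N / π ^ 2 := by
    rw [← Finset.sum_div, Finset.sum_add_distrib]
    simp_rw [pow_add]
    rw [← Finset.sum_mul, Fin.sum_univ_eq_sum_range (fun i => (-1 : ℝ) ^ i), neg_one_geom_sum,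
      if_pos hN]
    simp
  rw [← hsum, sampleEnergy, Finset.mul_sum, ← Finset.sum_sub_distrib, Finset.sum_div]
  exact (Finset.abs_sum_le_sum_abs _ _).trans (Finset.sum_le_sum fun i _ => hK i m hm)

end Sampling

section ConditionNumber

lemma condNumber_bounds {𝕜 E F : Type*} [RCLike 𝕜] [NormedAddCommGroup E] [NormedAddCommGroup F]
    [NormedSpace 𝕜 E] [NormedSpace 𝕜 F] [Nontrivial E] (A : E →ₗ[𝕜] F) {lo hi : ℝ} (hlo : 0 < lo)
    (hl : ∀ v, lo * ‖v‖ ^ 2 ≤ ‖A v‖ ^ 2) (hh : ∀ v, ‖A v‖ ^ 2 ≤ hi * ‖v‖ ^ 2) :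
    Function.Injective A ∧ 1 ≤ condNumber A ∧ condNumber A ≤ hi / lo := by
  obtain ⟨v₀, hv₀⟩ := exists_ne (0 : E)
  set v₁ : E := ((‖v₀‖⁻¹ : ℝ) : 𝕜) • v₀ with hv₁
  have hv₁n : ‖v₁‖ = 1 := by
    rw [hv₁, norm_smul, RCLike.norm_ofReal, abs_of_nonneg (by positivity),
      inv_mul_cancel₀ (norm_ne_zero_iff.2 hv₀)]
  have hne : ((fun v => ‖A v‖) '' {v : E | ‖v‖ = 1}).Nonempty := ⟨_, v₁, hv₁n, rfl⟩
  have hlow : ∀ r ∈ (fun v => ‖A v‖) '' {v : E | ‖v‖ = 1}, √lo ≤ r := by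
    rintro _ ⟨v, hv : ‖v‖ = 1, rfl⟩
    have := hl v
    rw [hv, one_pow, mul_one] at this
    exact Real.sqrt_le_iff.2 ⟨norm_nonneg _, this⟩
  have hup : ∀ r ∈ (fun v => ‖A v‖) '' {v : E | ‖v‖ = 1}, r ≤ √hi := by
    rintro _ ⟨v, hv : ‖v‖ = 1, rfl⟩
    have := hh v
    rw [hv, one_pow, mul_one] at this
    exact Real.le_sqrt_of_sq_le this
  have hlohi : lo ≤ hi := by
    have := (hl v₁).trans (hh v₁)
    simpa [hv₁n] using this
  have hmin : √lo ≤ sigmaMin A := le_csInf hne hlow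
  have hmin0 : 0 < sigmaMin A := (Real.sqrt_pos.2 hlo).trans_le hmin
  have hmax : sigmaMax A ≤ √hi := csSup_le hne hup
  refine ⟨(injective_iff_map_eq_zero A).2 fun v hv => ?_, ?_, ?_⟩
  · have := hl v
    rw [hv, norm_zero] at this
    by_contra h
    have : 0 < ‖v‖ := norm_pos_iff.2 h
    nlinarith [mul_pos hlo (pow_pos this 2)]
  · rw [condNumber, one_le_div hmin0]
    exact (csInf_le ⟨_, hlow⟩ ⟨v₁, hv₁n, rfl⟩).trans (le_csSup ⟨_, hup⟩ ⟨v₁, hv₁n, rfl⟩)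
  · calc sigmaMax A / sigmaMin A ≤ √hi / √lo := by gcongr
      _ = √(hi / lo) := (Real.sqrt_div' _ hlo.le).symm
      _ ≤ hi / lo := by
        have h1 : 1 ≤ hi / lo := (one_le_div hlo).2 hlohi
        exact Real.sqrt_le_iff.2 ⟨by linarith, by nlinarith⟩

end ConditionNumber

section Parseval

lemma sum_norm_sq_sum_mul {ι κ : Type*} [Fintype ι] [Fintype κ] [DecidableEq κ] (E : ι → κ → ℂ)
    (M : ℝ) (hE : ∀ q q', ∑ i, (starRingEnd ℂ) (E i q) * E i q' = if q = q' then (M : ℂ) else 0)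
    (w : κ → ℂ) : ∑ i, ‖∑ q, E i q * w q‖ ^ 2 = M * ∑ q, ‖w q‖ ^ 2 := by
  have h : (∑ i, (starRingEnd ℂ) (∑ q, E i q * w q) * ∑ q, E i q * w q) =
      M * ∑ q, (starRingEnd ℂ) (w q) * w q := by
    calc _ = ∑ i, ∑ q, ∑ q', (starRingEnd ℂ) (w q) * w q' *
          ((starRingEnd ℂ) (E i q) * E i q') := by
          refine Finset.sum_congr rfl fun i _ => ?_
          rw [map_sum, Finset.sum_mul_sum]
          refine Finset.sum_congr rfl fun q _ => Finset.sum_congr rfl fun q' _ => ?_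
          rw [map_mul]
          ring
      _ = ∑ q, ∑ q', (starRingEnd ℂ) (w q) * w q' *
          ∑ i, (starRingEnd ℂ) (E i q) * E i q' := by
          rw [Finset.sum_comm]
          refine Finset.sum_congr rfl fun q _ => ?_
          rw [Finset.sum_comm]
          simp_rw [Finset.mul_sum]
      _ = _ := by
          simp_rw [hE, mul_ite, mul_zero, Finset.sum_ite_eq, Finset.mem_univ, if_true,
            Finset.mul_sum]
          exact Finset.sum_congr rfl fun q _ => by ring
  simp_rw [Complex.conj_mul'] at h
  exact_mod_cast h

lemma colOrder_injective {N : ℕ} : Function.Injective (colOrder (N := N)) := by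
  rintro ⟨a, s⟩ ⟨b, t⟩ h
  cases s <;> cases t <;> simp [colOrder, Fin.ext_iff] at h ⊢ <;> omega

lemma abs_colOrder_le {N : ℕ} (q : Fin N × Bool) : |colOrder q| ≤ N := by
  have := q.1.2
  unfold colOrder
  split_ifs <;> rw [abs_le] <;> omega

/-- The Fourier mode `e^{ilθ_I}` on the uniform grid of angles. -/
noncomputable def fourierMode (N : ℕ) (I : ℕ) (l : ℤ) : ℂ :=
  Complex.exp (Complex.I * (l : ℂ) * ((2 * π * (I : ℝ) / (2 * N + 1) : ℝ) : ℂ))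

lemma sum_conj_fourierMode_mul {N : ℕ} (q q' : Fin N × Bool) :
    ∑ i : Fin (2 * N + 1), (starRingEnd ℂ) (fourierMode N i (colOrder q)) *
      fourierMode N i (colOrder q') = if q = q' then ((2 * N + 1 : ℝ) : ℂ) else 0 := by
  set d : ℤ := colOrder q' - colOrder q with hd
  set r : ℂ := Complex.exp (d / (2 * N + 1) * (2 * π * Complex.I)) with hr
  have hM : (2 * (N : ℂ) + 1) ≠ 0 := by exact_mod_cast (2 * N).succ_ne_zero
  have hterm : ∀ i : ℕ, (starRingEnd ℂ) (fourierMode N i (colOrder q)) *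
      fourierMode N i (colOrder q') = r ^ i := by
    intro i
    rw [fourierMode, fourierMode, ← Complex.exp_conj, ← Complex.exp_add, hr, ← Complex.exp_nat_mul]
    congr 1
    simp only [map_mul, Complex.conj_I, Complex.conj_ofReal, map_intCast, hd]
    push_cast
    field_simp
    ring
  simp_rw [hterm]
  rw [Fin.sum_univ_eq_sum_range (fun i => r ^ i)]
  split_ifs with h
  · have : r = 1 := by simp [hr, hd, h]
    simp [this]
  · have hr1 : r ≠ 1 := by
      intro h1
      obtain ⟨n, hn⟩ := Complex.exp_eq_one_iff.1 h1
      have h2 : (d : ℂ) / (2 * N + 1) = n := mul_right_cancel₀ Complex.two_pi_I_ne_zero hn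
      rw [div_eq_iff hM] at h2
      have h3 : d = n * (2 * N + 1) := by exact_mod_cast h2
      have h4 : d ≠ 0 := fun h0 => h (colOrder_injective (by omega))
      have h5 := abs_le.1 (abs_colOrder_le q)
      have h6 := abs_le.1 (abs_colOrder_le q')
      rcases lt_trichotomy n 0 with hn | hn | hn
      · nlinarith
      · simp [hn] at h3; exact h4 h3
      · nlinarith
    have hrM : r ^ (2 * N + 1) = 1 := by
      rw [hr, ← Complex.exp_nat_mul]
      refine Complex.exp_eq_one_iff.2 ⟨d, ?_⟩
      push_cast
      field_simp
    have := mul_geom_sum r (2 * N + 1)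
    rw [hrM, sub_self] at this
    exact (mul_eq_zero.1 this).resolve_left (sub_ne_zero.2 hr1)

lemma besselJ_colOrder_sq {N : ℕ} (q : Fin N × Bool) (x : ℝ) :
    besselJ (colOrder q) x ^ 2 = besselJnat (q.1 + 1) x ^ 2 := by
  obtain ⟨a, s⟩ := q
  cases s
  · have h1 : ¬ (0 : ℤ) ≤ -((a : ℤ) + 1) := by omega
    have h2 : (-((a : ℤ) + 1)).natAbs = a + 1 := by omega
    simp only [colOrder, besselJ, Bool.false_eq_true, if_false, h1, h2]
    rw [mul_pow, ← pow_mul, mul_comm _ 2, pow_mul]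
    simp
  · have h1 : (0 : ℤ) ≤ (a : ℤ) + 1 := by omega
    have h2 : ((a : ℤ) + 1).toNat = a + 1 := by omega
    simp only [colOrder, besselJ, if_true, h1, h2]

lemma norm_sq_toEuclideanLin_phasedMatrix (N m : ℕ) (v : EuclideanSpace ℂ (Fin N × Bool)) :
    ‖Matrix.toEuclideanLin (phasedMatrix N m) v‖ ^ 2 =
      (2 * N + 1) * ∑ q, sampleEnergy N m q.1 * ‖v q‖ ^ 2 := by
  have hentry : ∀ (i : Fin (2 * N + 1)) (j : Fin N),
      Matrix.toEuclideanLin (phasedMatrix N m) v (i, j) =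
        ∑ q, fourierMode N i (colOrder q) *
          ((besselJ (colOrder q) (samplePoint m j) : ℂ) * v q) := by
    intro i j
    rw [Matrix.ofLp_toLpLin, Matrix.toLin'_apply, Matrix.mulVec, dotProduct]
    exact Finset.sum_congr rfl fun q _ => mul_assoc _ _ _
  rw [EuclideanSpace.norm_sq_eq, Fintype.sum_prod_type, Finset.sum_comm]
  simp_rw [hentry]
  simp_rw [sum_norm_sq_sum_mul (fun (i : Fin (2 * N + 1)) q => fourierMode N i (colOrder q))
    (2 * N + 1 : ℝ) sum_conj_fourierMode_mul]
  rw [← Finset.mul_sum, Finset.sum_comm]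
  congr 1
  refine Finset.sum_congr rfl fun q _ => ?_
  rw [sampleEnergy, Finset.sum_mul]
  refine Finset.sum_congr rfl fun j _ => ?_
  rw [norm_mul, mul_pow, Complex.norm_real, Real.norm_eq_abs, sq_abs, besselJ_colOrder_sq]

end Parseval

/-- Theorem 7.2 of the paper: for the same measurement strategy, the phased complex
measurement matrix `Ã(m₀)` is eventually injective with `κ(Ã(m₀)) ≤ 1 + C_N/m₀`;
in particular `κ(Ã(m₀)) → 1` as `m₀ → ∞`. -/
theorem phased_condition_number (N : ℕ) (hN : 2 ≤ N) (hNeven : Even N) :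
    ∃ C : ℝ, 0 < C ∧ ∃ mstar : ℕ, 1 ≤ mstar ∧
      (∀ m₀ : ℕ, mstar ≤ m₀ →
        Function.Injective (Matrix.toEuclideanLin (phasedMatrix N m₀)) ∧
        condNumber (Matrix.toEuclideanLin (phasedMatrix N m₀)) ≤ 1 + C / (m₀ : ℝ)) ∧
      Filter.Tendsto (fun m₀ : ℕ => condNumber (Matrix.toEuclideanLin (phasedMatrix N m₀)))
        Filter.atTop (nhds 1) := by
  choose K hK using fun k : Fin N => exists_abs_mul_sampleEnergy_sub_le hNeven k
  have hN0 : (0 : ℝ) < N := by exact_mod_cast (by omega : 0 < N)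
  set D : ℝ := N / π ^ 2 with hD
  have hD0 : 0 < D := by positivity
  set B : ℝ := ∑ k, |K k| with hB
  have hB0 : 0 ≤ B := Finset.sum_nonneg fun k _ => abs_nonneg _
  have : Nonempty (Fin N × Bool) := ⟨(⟨0, by omega⟩, true)⟩
  have henergy : ∀ (k : Fin N) (m : ℕ), 1 ≤ m → |m * sampleEnergy N m k - D| ≤ B / m :=
    fun k m hm => (hK k m hm).trans (by
      gcongr
      exact (le_abs_self _).trans
        (Finset.single_le_sum (f := fun k => |K k|) (fun _ _ => abs_nonneg _) (Finset.mem_univ k)))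
  have key : ∀ m : ℕ, ⌈2 * B / D⌉₊ + 1 ≤ m →
      Function.Injective (Matrix.toEuclideanLin (phasedMatrix N m)) ∧
      1 ≤ condNumber (Matrix.toEuclideanLin (phasedMatrix N m)) ∧
      condNumber (Matrix.toEuclideanLin (phasedMatrix N m)) ≤ 1 + (4 * B / D + 1) / (m : ℝ) := by
    intro m hm
    have hm1 : 1 ≤ m := by omega
    have hm0 : (0 : ℝ) < m := by exact_mod_cast hm1
    have hmB : 2 * B / D ≤ m := (Nat.le_ceil _).trans (by exact_mod_cast (by omega))
    set t : ℝ := B / m with ht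
    have ht0 : 0 ≤ t := by positivity
    have htD : 2 * t ≤ D := by
      rw [div_le_iff₀ hD0] at hmB
      rw [ht, ← mul_div_assoc, div_le_iff₀ hm0]
      linarith
    have hbd : ∀ k : Fin N, (D - t) / m ≤ sampleEnergy N m k ∧
        sampleEnergy N m k ≤ (D + t) / m := by
      intro k
      have := abs_le.1 (henergy k m hm1)
      rw [div_le_iff₀ hm0, le_div_iff₀ hm0]
      constructor <;> linarith
    obtain ⟨h1, h2, h3⟩ := condNumber_bounds (Matrix.toEuclideanLin (phasedMatrix N m))
      (lo := (2 * N + 1) * ((D - t) / m)) (hi := (2 * N + 1) * ((D + t) / m))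
      (mul_pos (by positivity) (div_pos (by linarith) hm0))
      (fun v => by
        rw [norm_sq_toEuclideanLin_phasedMatrix, EuclideanSpace.norm_sq_eq, mul_assoc,
          Finset.mul_sum]
        gcongr with q
        exact (hbd q.1).1)
      (fun v => by
        rw [norm_sq_toEuclideanLin_phasedMatrix, EuclideanSpace.norm_sq_eq, mul_assoc,
          Finset.mul_sum (a := (D + t) / m)]
        gcongr with q
        exact (hbd q.1).2)
    refine ⟨h1, h2, h3.trans ?_⟩
    have hDt : 0 < D - t := by linarith
    have hratio : (2 * (N : ℝ) + 1) * ((D + t) / m) / ((2 * N + 1) * ((D - t) / m)) =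
        (D + t) / (D - t) := by
      field_simp
    have hC : (4 * B / D + 1) / (m : ℝ) = 4 * t / D + 1 / m := by rw [ht]; ring
    rw [hratio, hC, div_le_iff₀ hDt]
    have h4 : 4 * t / D * (D - t) = 4 * t - 2 * t * (2 * t / D) := by field_simp; ring
    have h5 : 2 * t / D ≤ 1 := (div_le_one hD0).2 htD
    have h6 : 0 ≤ 1 / (m : ℝ) * (D - t) := by positivity
    nlinarith
  refine ⟨4 * B / D + 1, by positivity, ⌈2 * B / D⌉₊ + 1, by omega,
    fun m hm => ⟨(key m hm).1, (key m hm).2.2⟩, ?_⟩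
  refine tendsto_of_tendsto_of_tendsto_of_le_of_le' tendsto_const_nhds
    (h := fun m : ℕ => 1 + (4 * B / D + 1) / (m : ℝ)) ?_ ?_ ?_
  · simpa using (tendsto_const_div_atTop_nhds_zero_nat (4 * B / D + 1)).const_add 1
  · filter_upwards [Filter.eventually_ge_atTop (⌈2 * B / D⌉₊ + 1)] with m hm
    exact (key m hm).2.1
  · filter_upwards [Filter.eventually_ge_atTop (⌈2 * B / D⌉₊ + 1)] with m hm
    exact (key m hm).2.2
end
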